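/- arXiv:2309.15665 — 11 statements merged into one kernel-verified Lean document; each statement's English description precedes it below -/
import Mathlib

section
/- Under any non-negative initial conditions X(0) ≥ 0, Y(0) ≥ 0, D(0) ≥ 0, V(0) ≥ 0, every solution of the HBV system remains non-negative: X(t) ≥ 0, Y(t) ≥ 0, D(t) ≥ 0 and V(t) ≥ 0 for all t ≥ 0. -/
theorem hasDerivAt_negPart_sq (x : ℝ) :
    HasDerivAt (fun y : ℝ => (min y 0) ^ 2) (2 * min x 0) x := by
  have key : HasFDerivAt (fun y : ℝ => (min y 0) ^ 2 - (2 * min x 0) * y) (0 : ℝ →L[ℝ] ℝ) x := by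
    have h1 : (fun y : ℝ => (min y 0) ^ 2 - (min x 0) ^ 2 - (2 * min x 0) * (y - x))
        =O[nhds x] fun y => ‖y - x‖ ^ 2 := by
      refine Asymptotics.IsBigO.of_bound 1 (Filter.Eventually.of_forall fun y => ?_)
      simp only [Real.norm_eq_abs, abs_pow, sq_abs, one_mul]
      rw [abs_le]
      rcases le_total x 0 with hx | hx <;> rcases le_total y 0 with hy | hy <;>
        simp only [hx, hy, min_eq_left, min_eq_right] <;> constructor <;>
        nlinarith [sq_nonneg x, sq_nonneg y, sq_nonneg (y - x)]
    have h2 := h1.hasFDerivAt (𝕜 := ℝ) (by norm_num)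
    have h3 := h2.add_const ((min x 0) ^ 2 - (2 * min x 0) * x)
    refine h3.congr_of_eventuallyEq (Filter.Eventually.of_forall fun y => ?_)
    simp only
    ring
  have h4 := key.hasDerivAt.add ((hasDerivAt_id x).const_mul (2 * min x 0))
  have e1 : ((fun y : ℝ => min y 0 ^ 2 - 2 * min x 0 * y) + fun y => 2 * min x 0 * id y)
      = fun y : ℝ => (min y 0) ^ 2 := by
    funext y; simp
  rw [e1] at h4
  simpa using h4

theorem gronwall_zero (W W' : ℝ → ℝ) (C T : ℝ) (hT : 0 ≤ T)
    (hW : ∀ t, HasDerivAt W (W' t) t) (hb : ∀ t ∈ Set.Icc 0 T, W' t ≤ C * W t)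
    (h0 : W 0 = 0) : W T ≤ 0 := by
  have hd : ∀ t, HasDerivAt (fun t => W t * Real.exp (-C * t))
      (W' t * Real.exp (-C * t) + W t * (Real.exp (-C * t) * (-C * 1))) t := fun t =>
    (hW t).mul (((hasDerivAt_id t).const_mul (-C)).exp)
  have hanti : AntitoneOn (fun t => W t * Real.exp (-C * t)) (Set.Icc 0 T) := by
    refine antitoneOn_of_hasDerivWithinAt_nonpos (convex_Icc 0 T)
      (fun t _ => (hd t).continuousAt.continuousWithinAt)
      (fun t _ => (hd t).hasDerivWithinAt) ?_
    intro t ht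
    have := hb t (interior_subset ht)
    nlinarith [Real.exp_pos (-C * t)]
  have h := hanti (Set.left_mem_Icc.2 hT) (Set.right_mem_Icc.2 hT) hT
  simp only [h0, zero_mul] at h
  by_contra hc
  push Not at hc
  exact absurd (mul_pos hc (Real.exp_pos (-C * T))) (not_lt.2 h)

theorem min_mul_self_eq (x : ℝ) : min x 0 * x = (min x 0) ^ 2 := by
  rcases le_total x 0 with hx | hx <;> simp [hx, sq]

theorem nonneg_of_min_sq (x : ℝ) (h : (min x 0) ^ 2 ≤ 0) : 0 ≤ x := by
  have : min x 0 = 0 := 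
    (pow_eq_zero_iff two_ne_zero).1 (le_antisymm h (sq_nonneg (min x 0)))
  exact min_eq_right_iff.1 this

/-- Non-negativity of solutions of the HBV model with capsid recycling:
under non-negative initial conditions, every solution of
dX/dt = λ − μX − kVX, dY/dt = kVX − δY,
dD/dt = aY + γ(1−α)D − αβD − δD, dV/dt = αβD − cV
remains non-negative for all t ≥ 0. -/
theorem hbv_nonnegativity
    (lam μ k δ a β γ c α : ℝ)
    (hlam : 0 < lam) (hμ : 0 < μ) (hk : 0 < k) (hδ : 0 < δ)
    (ha : 0 < a) (hβ : 0 < β) (hγ : 0 < γ) (hc : 0 < c)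
    (hα : α ∈ Set.Ioo (0 : ℝ) 1)
    (X Y D V : ℝ → ℝ)
    (hX : ∀ t, HasDerivAt X (lam - μ * X t - k * V t * X t) t)
    (hY : ∀ t, HasDerivAt Y (k * V t * X t - δ * Y t) t)
    (hD : ∀ t, HasDerivAt D (a * Y t + γ * (1 - α) * D t - α * β * D t - δ * D t) t)
    (hV : ∀ t, HasDerivAt V (α * β * D t - c * V t) t)
    (hX0 : 0 ≤ X 0) (hY0 : 0 ≤ Y 0) (hD0 : 0 ≤ D 0) (hV0 : 0 ≤ V 0) :
    ∀ t ≥ (0 : ℝ), 0 ≤ X t ∧ 0 ≤ Y t ∧ 0 ≤ D t ∧ 0 ≤ V t := by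
  obtain ⟨hα0, hα1⟩ := hα
  have hXn : ∀ t ≥ (0 : ℝ), 0 ≤ X t := by
    intro T hT
    have hVc : Continuous V := continuous_iff_continuousAt.2 fun t => (hV t).continuousAt
    obtain ⟨M, hM⟩ := isCompact_Icc.exists_bound_of_continuousOn (s := Set.Icc 0 T) hVc.continuousOn
    apply nonneg_of_min_sq
    refine gronwall_zero (fun t => (min (X t) 0) ^ 2) _ (2 * k * M) T hT
      (fun t => (hasDerivAt_negPart_sq (X t)).comp t (hX t)) ?_ (by simp [hX0])
    intro t ht
    have h1 := (abs_le.1 (hM t ht)).1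
    have h2 := min_mul_self_eq (X t)
    have h3 : min (X t) 0 ≤ 0 := min_le_right _ _
    have e : 2 * min (X t) 0 * (lam - μ * X t - k * V t * X t)
        = 2 * lam * min (X t) 0 - 2 * (μ + k * V t) * (min (X t) 0) ^ 2 := by
      rw [← h2]; ring
    rw [e]
    have h4 : 0 ≤ k * (M + V t) * (min (X t) 0) ^ 2 :=
      mul_nonneg (mul_nonneg hk.le (by linarith)) (sq_nonneg _)
    nlinarith [mul_nonneg hμ.le (sq_nonneg (min (X t) 0)), mul_nonneg hlam.le (neg_nonneg.2 h3)]
  intro T hT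
  have hXc : Continuous X := continuous_iff_continuousAt.2 fun t => (hX t).continuousAt
  obtain ⟨M, hM⟩ := isCompact_Icc.exists_bound_of_continuousOn (s := Set.Icc 0 T) hXc.continuousOn
  have hW : (min (Y T) 0) ^ 2 + (min (D T) 0) ^ 2 + (min (V T) 0) ^ 2 ≤ 0 := by
    refine gronwall_zero (fun t => (min (Y t) 0) ^ 2 + (min (D t) 0) ^ 2 + (min (V t) 0) ^ 2) _
      (k * M + a + 2 * γ + α * β) T hT
      (fun t => (((hasDerivAt_negPart_sq (Y t)).comp t (hY t)).add
        ((hasDerivAt_negPart_sq (D t)).comp t (hD t))).add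
        ((hasDerivAt_negPart_sq (V t)).comp t (hV t))) ?_ (by simp [hY0, hD0, hV0])
    intro t ht
    have hx0 := hXn t ht.1
    have hxM : X t ≤ M := (abs_le.1 (hM t ht)).2
    have ey := min_mul_self_eq (Y t)
    have ed := min_mul_self_eq (D t)
    have ev := min_mul_self_eq (V t)
    have ny : min (Y t) 0 ≤ 0 := min_le_right _ _
    have nd : min (D t) 0 ≤ 0 := min_le_right _ _
    have nv : min (V t) 0 ≤ 0 := min_le_right _ _
    have ly : min (Y t) 0 ≤ Y t := min_le_left _ _
    have ld : min (D t) 0 ≤ D t := min_le_left _ _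
    have lv : min (V t) 0 ≤ V t := min_le_left _ _
    generalize min (Y t) 0 = y at *
    generalize min (D t) 0 = d at *
    generalize min (V t) 0 = v at *
    have hab : 0 < α * β := mul_pos hα0 hβ
    have hM0 : 0 ≤ M := hx0.trans hxM
    have b1 : 2 * y * (k * V t * X t - δ * Y t) ≤ k * M * (y ^ 2 + v ^ 2) := by
      have i1 : 0 ≤ k * X t * (-y * (V t - v)) :=
        mul_nonneg (mul_nonneg hk.le hx0) (mul_nonneg (by linarith) (by linarith))
      have i2 : 0 ≤ k * X t * (y - v) ^ 2 := mul_nonneg (mul_nonneg hk.le hx0) (sq_nonneg _)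
      have i3 : 0 ≤ k * (M - X t) * (y ^ 2 + v ^ 2) :=
        mul_nonneg (mul_nonneg hk.le (by linarith)) (by positivity)
      have i4 : 0 ≤ δ * (y * Y t) := by rw [ey]; positivity
      nlinarith
    have b2 : 2 * d * (a * Y t + γ * (1 - α) * D t - α * β * D t - δ * D t)
        ≤ a * (y ^ 2 + d ^ 2) + 2 * γ * d ^ 2 := by
      have i1 : 0 ≤ a * (-d * (Y t - y)) :=
        mul_nonneg ha.le (mul_nonneg (by linarith) (by linarith))
      have i2 : 0 ≤ a * (y - d) ^ 2 := by positivity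
      have e : 2 * d * (a * Y t + γ * (1 - α) * D t - α * β * D t - δ * D t)
          = 2 * a * (d * Y t) + 2 * (γ - γ * α - α * β - δ) * d ^ 2 := by rw [← ed]; ring
      have i3 : 0 ≤ (γ * α + α * β + δ) * d ^ 2 := by positivity
      rw [e]
      nlinarith
    have b3 : 2 * v * (α * β * D t - c * V t) ≤ α * β * (d ^ 2 + v ^ 2) := by
      have i1 : 0 ≤ α * β * (-v * (D t - d)) :=
        mul_nonneg hab.le (mul_nonneg (by linarith) (by linarith))
      have i2 : 0 ≤ α * β * (d - v) ^ 2 := by positivity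
      have i4 : 0 ≤ c * (v * V t) := by rw [ev]; positivity
      nlinarith
    have j1 : 0 ≤ k * M * d ^ 2 := by positivity
    have j2 : 0 ≤ a * v ^ 2 := by positivity
    have j3 : 0 ≤ γ * (y ^ 2 + v ^ 2) := by positivity
    have j4 : 0 ≤ α * β * y ^ 2 := by positivity
    nlinarith
  have sy := sq_nonneg (min (Y T) 0)
  have sd := sq_nonneg (min (D T) 0)
  have sv := sq_nonneg (min (V T) 0)
  exact ⟨hXn T hT, nonneg_of_min_sq _ (by linarith), nonneg_of_min_sq _ (by linarith),
    nonneg_of_min_sq _ (by linarith)⟩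
end

section
/- Let ρ = min(μ, δ) and assume R_s = αβ − (1−α)γ + δ > 0. For any solution of the HBV system with non-negative initial conditions, limsup_{t→∞} (X(t) + Y(t)) ≤ λ/ρ, limsup_{t→∞} D(t) ≤ aλ/(ρ(αβ + δ − γ(1−α))), and limsup_{t→∞} V(t) ≤ aλαβ/(ρc(αβ + δ − γ(1−α))); in particular X, Y, D and V are bounded on [0, ∞). -/
open Filter

lemma hbv_aux_sq (x : ℝ) : HasDerivAt (fun y : ℝ => (min y 0)^2) (2 * min x 0) x := by
  rw [hasDerivAt_iff_isLittleO]
  have h1 : (fun y : ℝ => (min y 0)^2 - (min x 0)^2 - (y - x) • (2 * min x 0))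
      =O[nhds x] fun y => (y - x)^2 := by
    apply Asymptotics.IsBigO.of_bound 1
    refine Eventually.of_forall fun y => ?_
    rw [Real.norm_eq_abs, Real.norm_eq_abs, one_mul, abs_of_nonneg (sq_nonneg (y - x)), abs_le,
      smul_eq_mul]
    rcases le_total y 0 with h | h <;> rcases le_total x 0 with h' | h' <;>
      simp only [min_eq_left, min_eq_right, h, h'] <;> constructor <;>
      nlinarith [mul_nonneg (abs_nonneg x) (abs_nonneg y), sq_nonneg (x - y), sq_nonneg x,
        sq_nonneg y]
  refine h1.trans_isLittleO ?_
  have h2 := Asymptotics.isLittleO_pow_sub_sub x (m := 2) (by norm_num)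
  simpa [Real.norm_eq_abs, sq_abs] using h2

lemma hbv_aux_gron (p f f' : ℝ → ℝ) (hp : Continuous p) (hf : ∀ t, HasDerivAt f (f' t) t)
    (T : ℝ) (h : ∀ t ≥ T, f' t ≤ p t * f t) (h0 : f T ≤ 0) : ∀ t ≥ T, f t ≤ 0 := by
  set P : ℝ → ℝ := fun t => ∫ s in T..t, p s with hP
  have hPd : ∀ t, HasDerivAt P (p t) t := fun t =>
    intervalIntegral.integral_hasDerivAt_right (hp.intervalIntegrable _ _)
      hp.aestronglyMeasurable.stronglyMeasurableAtFilter hp.continuousAt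
  have hg : ∀ t, HasDerivAt (fun t => Real.exp (- P t) * f t)
      (Real.exp (- P t) * (- p t) * f t + Real.exp (- P t) * f' t) t := fun t =>
    ((hPd t).neg.exp).mul (hf t)
  have ha : AntitoneOn (fun t => Real.exp (- P t) * f t) (Set.Ici T) := by
    apply antitoneOn_of_deriv_nonpos (convex_Ici T)
    · exact fun t _ => (hg t).continuousAt.continuousWithinAt
    · exact fun t _ => (hg t).differentiableAt.differentiableWithinAt
    · intro t ht
      rw [interior_Ici] at ht
      rw [(hg t).deriv]
      have := mul_nonneg (Real.exp_pos (- P t)).le (sub_nonneg.2 (h t (le_of_lt ht)))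
      nlinarith
  intro t ht
  have h1 := ha (Set.self_mem_Ici) (Set.mem_Ici.2 ht) ht
  have h2 : Real.exp (- P T) * f T ≤ 0 :=
    mul_nonpos_of_nonneg_of_nonpos (Real.exp_pos _).le h0
  have h3 : Real.exp (- P t) * f t ≤ 0 := le_trans h1 h2
  by_contra hc
  push Not at hc
  have := mul_pos (Real.exp_pos (- P t)) hc
  linarith

lemma hbv_aux_cmp (f f' : ℝ → ℝ) (hf : ∀ t, HasDerivAt f (f' t) t) (A r T : ℝ) (hr : 0 < r)
    (h : ∀ t ≥ T, f' t ≤ A - r * f t) :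
    ∀ t ≥ T, f t ≤ A / r + (f T - A / r) * Real.exp (- r * (t - T)) := by
  have hg : ∀ t, HasDerivAt
      (fun t => f t - (A / r + (f T - A / r) * Real.exp (- r * (t - T))))
      (f' t - (f T - A / r) * (Real.exp (- r * (t - T)) * (- r))) t := by
    intro t
    have h1 : HasDerivAt (fun t : ℝ => - r * (t - T)) (- r) t := by
      simpa using ((hasDerivAt_id t).sub_const T).const_mul (- r)
    exact (hf t).sub ((h1.exp.const_mul (f T - A / r)).const_add (A / r))
  intro t ht
  have := hbv_aux_gron (fun _ => - r) _ _ continuous_const hg T (fun t ht => by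
    have h1 := h t ht
    have h2 : r * (A / r) = A := by field_simp
    nlinarith) (by simp) t ht
  linarith

lemma hbv_aux_bdd (f f' : ℝ → ℝ) (hf : ∀ t, HasDerivAt f (f' t) t) (A r T : ℝ) (hr : 0 < r)
    (h : ∀ t ≥ T, f' t ≤ A - r * f t) : ∀ t ≥ T, f t ≤ |A / r| + |f T - A / r| := by
  intro t ht
  have h1 := hbv_aux_cmp f f' hf A r T hr h t ht
  have h2 : Real.exp (- r * (t - T)) ≤ 1 := by
    rw [Real.exp_le_one_iff]
    nlinarith [mul_nonneg hr.le (sub_nonneg.2 ht)]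
  have h3 := le_abs_self (A / r)
  have h4 : (f T - A / r) * Real.exp (- r * (t - T)) ≤ |f T - A / r| * 1 :=
    mul_le_mul (le_abs_self _) h2 (Real.exp_pos _).le (abs_nonneg _)
  linarith

lemma hbv_aux_ev (f f' u : ℝ → ℝ) (hf : ∀ t, HasDerivAt f (f' t) t) (U r : ℝ) (hr : 0 < r)
    (h : ∀ t ≥ 0, f' t ≤ u t - r * f t) (hu : ∀ ε > 0, ∀ᶠ t in atTop, u t ≤ U + ε) :
    ∀ ε > 0, ∀ᶠ t in atTop, f t ≤ U / r + ε := by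
  intro ε hε
  obtain ⟨T, hT⟩ := eventually_atTop.1 (hu (r * (ε / 2)) (by positivity))
  have hc := hbv_aux_cmp f f' hf (U + r * (ε / 2)) r (max T 0) hr (fun t ht => by
    have h1 := h t (le_trans (le_max_right _ _) ht)
    have h2 := hT t (le_trans (le_max_left _ _) ht)
    linarith)
  set S := max T 0
  set C := f S - (U + r * (ε / 2)) / r
  have hlim : Tendsto (fun t : ℝ => C * Real.exp (- r * (t - S))) atTop (nhds (C * 0)) := by
    apply Tendsto.const_mul
    apply Real.tendsto_exp_atBot.comp
    exact (tendsto_atTop_add_const_right _ (-S) tendsto_id).const_mul_atTop_of_neg (by linarith)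
  rw [mul_zero] at hlim
  filter_upwards [eventually_ge_atTop S, hlim.eventually_lt_const (half_pos hε)] with t h1 h2
  have h3 := hc t h1
  have h4 : (U + r * (ε / 2)) / r = U / r + ε / 2 := by field_simp
  linarith

lemma hbv_aux_limsup (f : ℝ → ℝ) (b : ℝ) (h0 : ∀ t ≥ 0, 0 ≤ f t)
    (h : ∀ ε > 0, ∀ᶠ t in atTop, f t ≤ b + ε) : limsup f atTop ≤ b := by
  apply le_of_forall_pos_le_add
  intro ε hε
  refine limsup_le_of_le ?_ (h ε hε)
  apply IsBoundedUnder.isCoboundedUnder_le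
  exact ⟨0, eventually_map.2 (by filter_upwards [eventually_ge_atTop 0] with t ht using h0 t ht)⟩

/-- Boundedness of solutions of the HBV model: with ρ = min(μ, δ) and
R_s = αβ − (1−α)γ + δ > 0, for any solution with non-negative initial data,
limsup (X+Y) ≤ λ/ρ, limsup D ≤ aλ/(ρ(αβ+δ−γ(1−α))),
limsup V ≤ aλαβ/(ρc(αβ+δ−γ(1−α))), and X, Y, D, V are bounded on [0, ∞). -/
theorem hbv_boundedness
    (lam μ k δ a β γ c α ρ : ℝ)
    (hlam : 0 < lam) (hμ : 0 < μ) (hk : 0 < k) (hδ : 0 < δ)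
    (ha : 0 < a) (hβ : 0 < β) (hγ : 0 < γ) (hc : 0 < c)
    (hα : α ∈ Set.Ioo (0 : ℝ) 1)
    (hρ : ρ = min μ δ)
    (hRs : 0 < α * β - (1 - α) * γ + δ)
    (X Y D V : ℝ → ℝ)
    (hX : ∀ t, HasDerivAt X (lam - μ * X t - k * V t * X t) t)
    (hY : ∀ t, HasDerivAt Y (k * V t * X t - δ * Y t) t)
    (hD : ∀ t, HasDerivAt D (a * Y t + γ * (1 - α) * D t - α * β * D t - δ * D t) t)
    (hV : ∀ t, HasDerivAt V (α * β * D t - c * V t) t)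
    (hX0 : 0 ≤ X 0) (hY0 : 0 ≤ Y 0) (hD0 : 0 ≤ D 0) (hV0 : 0 ≤ V 0) :
    limsup (fun t => X t + Y t) atTop ≤ lam / ρ ∧
    limsup D atTop ≤ a * lam / (ρ * (α * β + δ - γ * (1 - α))) ∧
    limsup V atTop ≤ a * lam * α * β / (ρ * c * (α * β + δ - γ * (1 - α))) ∧
    (∃ M : ℝ, ∀ t ≥ (0 : ℝ), |X t| ≤ M ∧ |Y t| ≤ M ∧ |D t| ≤ M ∧ |V t| ≤ M) := by
  obtain ⟨hα0, hα1⟩ := hα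
  have hαβ : 0 < α * β := mul_pos hα0 hβ
  have hρ0 : 0 < ρ := by rw [hρ]; exact lt_min hμ hδ
  have hρμ : ρ ≤ μ := by rw [hρ]; exact min_le_left _ _
  have hρδ : ρ ≤ δ := by rw [hρ]; exact min_le_right _ _
  obtain ⟨R, hR⟩ : ∃ R, R = α * β + δ - γ * (1 - α) := ⟨_, rfl⟩
  have hR0 : 0 < R := by rw [hR]; linarith
  rw [← hR]
  have cX : Continuous X := continuous_iff_continuousAt.2 fun t => (hX t).continuousAt
  have cV : Continuous V := continuous_iff_continuousAt.2 fun t => (hV t).continuousAt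
  have pX : ∀ t ≥ 0, 0 ≤ X t := by
    intro t ht
    have := hbv_aux_gron (fun t => -(μ + k * V t)) (fun t => - X t) _ (by fun_prop)
      (fun t => (hX t).neg) 0 (fun t _ => by nlinarith) (by simpa using hX0) t ht
    simpa using this
  have hN : ∀ t, HasDerivAt (fun t => (min (Y t) 0)^2 + (min (D t) 0)^2 + (min (V t) 0)^2) _ t :=
    fun t => (((hbv_aux_sq (Y t)).comp t (hY t)).add ((hbv_aux_sq (D t)).comp t (hD t))).add
      ((hbv_aux_sq (V t)).comp t (hV t))
  have hN0 := hbv_aux_gron (fun t => k * X t + a + α * β) _ _ (by fun_prop) hN 0 (by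
    intro t ht
    have key : ∀ x : ℝ, min x 0 ≤ 0 ∧ min x 0 ≤ x ∧ min x 0 * x = (min x 0)^2 := by
      intro x
      refine ⟨min_le_right _ _, min_le_left _ _, ?_⟩
      rcases le_total x 0 with h | h <;> simp [h, sq]
    have cross : ∀ s x y : ℝ, 0 ≤ s →
        2 * (s * (min x 0 * y)) ≤ s * ((min x 0)^2 + (min y 0)^2) := by
      intro s x y hs
      have h1 : min x 0 * y ≤ min x 0 * min y 0 :=
        mul_le_mul_of_nonpos_left (key y).2.1 (key x).1
      have h2 : 2 * (min x 0 * y) ≤ (min x 0)^2 + (min y 0)^2 := by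
        nlinarith [sq_nonneg (min x 0 - min y 0)]
      nlinarith [mul_le_mul_of_nonneg_left h2 hs]
    have hkX : 0 ≤ k * X t := mul_nonneg hk.le (pX t ht)
    have e1 := cross (k * X t) (Y t) (V t) hkX
    have e2 := cross a (D t) (Y t) ha.le
    have e3 := cross (α * β) (V t) (D t) hαβ.le
    have f1 := (key (Y t)).2.2
    have f2 := (key (D t)).2.2
    have f3 := (key (V t)).2.2
    have g1 := sq_nonneg (min (Y t) 0)
    have g2 := sq_nonneg (min (D t) 0)
    have g3 := sq_nonneg (min (V t) 0)
    generalize min (Y t) 0 = y at *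
    generalize min (D t) 0 = d at *
    generalize min (V t) 0 = v at *
    have i1 : 2 * y * (k * V t * X t - δ * Y t) = 2 * (k * X t * (y * V t)) - 2 * δ * y^2 := by
      rw [← f1]; ring
    have i2 : 2 * d * (a * Y t + γ * (1 - α) * D t - α * β * D t - δ * D t)
        = 2 * (a * (d * Y t)) - 2 * R * d^2 := by
      rw [← f2, hR]; ring
    have i3 : 2 * v * (α * β * D t - c * V t) = 2 * (α * β * (v * D t)) - 2 * c * v^2 := by
      rw [← f3]; ring
    rw [i1, i2, i3]
    have j1 := mul_nonneg hδ.le g1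
    have j2 := mul_nonneg hR0.le g2
    have j3 := mul_nonneg hc.le g3
    have j4 := mul_nonneg hkX g2
    have j5 := mul_nonneg ha.le g3
    have j6 := mul_nonneg hαβ.le g1
    linarith) (by simp [hY0, hD0, hV0])
  have aux : ∀ x : ℝ, (min x 0)^2 ≤ 0 → 0 ≤ x := by
    intro x hx
    have : min x 0 = 0 := pow_eq_zero_iff (two_ne_zero) |>.1 (le_antisymm hx (sq_nonneg _))
    exact min_eq_right_iff.1 this
  have pos : ∀ t ≥ 0, 0 ≤ Y t ∧ 0 ≤ D t ∧ 0 ≤ V t := by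
    intro t ht
    have h1 := hN0 t ht
    have g1 := sq_nonneg (min (Y t) 0)
    have g2 := sq_nonneg (min (D t) 0)
    have g3 := sq_nonneg (min (V t) 0)
    exact ⟨aux _ (by linarith), aux _ (by linarith), aux _ (by linarith)⟩
  have dXY : ∀ t, HasDerivAt (fun t => X t + Y t) _ t := fun t => (hX t).add (hY t)
  have iXY : ∀ t ≥ 0, (lam - μ * X t - k * V t * X t) + (k * V t * X t - δ * Y t)
      ≤ lam - ρ * (X t + Y t) := by
    intro t ht
    have h1 := mul_nonneg (sub_nonneg.2 hρμ) (pX t ht)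
    have h2 := mul_nonneg (sub_nonneg.2 hρδ) (pos t ht).1
    linarith
  have iD : ∀ t ≥ (0 : ℝ), a * Y t + γ * (1 - α) * D t - α * β * D t - δ * D t
      ≤ a * Y t - R * D t := by
    intro t ht
    rw [hR]; linarith
  have eXY := hbv_aux_ev _ _ (fun _ => lam) dXY lam ρ hρ0 iXY
    (fun ε hε => Eventually.of_forall fun t => by linarith)
  have eD := hbv_aux_ev _ _ (fun t => a * Y t) hD (a * (lam / ρ)) R hR0 iD (by
    intro ε hε
    filter_upwards [eXY (ε / a) (by positivity), eventually_ge_atTop 0] with t h1 h2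
    have h3 := pX t h2
    have h4 : a * Y t ≤ a * (lam / ρ + ε / a) := mul_le_mul_of_nonneg_left (by linarith) ha.le
    have h5 : a * (ε / a) = ε := by field_simp
    linarith)
  have eV := hbv_aux_ev _ _ (fun t => α * β * D t) hV (α * β * (a * (lam / ρ) / R)) c hc
    (fun t _ => le_rfl) (by
    intro ε hε
    filter_upwards [eD (ε / (α * β)) (by positivity)] with t h1
    have h4 := mul_le_mul_of_nonneg_left h1 hαβ.le
    have h5 : α * β * (ε / (α * β)) = ε := by field_simp
    linarith)
  refine ⟨hbv_aux_limsup _ _ (fun t ht => add_nonneg (pX t ht) (pos t ht).1) eXY, ?_, ?_, ?_⟩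
  · have : a * lam / (ρ * R) = a * (lam / ρ) / R := by field_simp
    rw [this]
    exact hbv_aux_limsup _ _ (fun t ht => (pos t ht).2.1) eD
  · have : a * lam * α * β / (ρ * c * R) = α * β * (a * (lam / ρ) / R) / c := by field_simp
    rw [this]
    exact hbv_aux_limsup _ _ (fun t ht => (pos t ht).2.2) eV
  · obtain ⟨M1, hM1⟩ : ∃ M, ∀ t ≥ (0 : ℝ), X t + Y t ≤ M :=
      ⟨_, hbv_aux_bdd _ _ dXY lam ρ 0 hρ0 iXY⟩
    obtain ⟨M2, hM2⟩ : ∃ M, ∀ t ≥ (0 : ℝ), D t ≤ M :=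
      ⟨_, hbv_aux_bdd _ _ hD (a * M1) R 0 hR0 (fun t ht => by
        have h1 := iD t ht
        have h2 : a * Y t ≤ a * M1 :=
          mul_le_mul_of_nonneg_left (by linarith [hM1 t ht, pX t ht]) ha.le
        linarith)⟩
    obtain ⟨M3, hM3⟩ : ∃ M, ∀ t ≥ (0 : ℝ), V t ≤ M :=
      ⟨_, hbv_aux_bdd _ _ hV (α * β * M2) c 0 hc (fun t ht => by
        have h2 := mul_le_mul_of_nonneg_left (hM2 t ht) hαβ.le
        linarith)⟩
    refine ⟨max M1 (max M2 M3), fun t ht => ?_⟩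
    obtain ⟨h1, h2, h3⟩ := pos t ht
    have h0 := pX t ht
    rw [abs_of_nonneg h0, abs_of_nonneg h1, abs_of_nonneg h2, abs_of_nonneg h3]
    have := hM1 t ht
    refine ⟨le_max_of_le_left (by linarith), le_max_of_le_left (by linarith),
      le_max_of_le_right (le_max_of_le_left (hM2 t ht)),
      le_max_of_le_right (le_max_of_le_right (hM3 t ht))⟩
end

section
/- Assume R_s = αβ − (1−α)γ + δ > 0. Let F be the 3×3 real matrix with first row (0, 0, kλ/μ) and all other entries 0, and let V be the 3×3 real matrix with rows (δ, 0, 0), (−a, −γ(1−α) + αβ + δ, 0), (0, −αβ, c). Then V is invertible and the spectral radius of F·V⁻¹ equals akλαβ/((cαβδ − cγδ + cαγδ + cδ²)μ), i.e. the basic reproduction number R_0 = akλαβ/(cδμR_s). -/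
/-- Spectral radius of a real 3×3 matrix supported on its first row. -/
theorem spectralRadius_first_row (x y z : ℝ) (hx : 0 ≤ x) :
    spectralRadius ℝ (!![x, y, z; 0, 0, 0; 0, 0, 0] : Matrix (Fin 3) (Fin 3) ℝ) =
      ENNReal.ofReal x := by
  have key : ∀ r : ℝ, r ∈ spectrum ℝ (!![x, y, z; 0, 0, 0; 0, 0, 0] : Matrix (Fin 3) (Fin 3) ℝ) ↔
      r = x ∨ r = 0 := by
    intro r
    rw [spectrum.mem_iff, Matrix.isUnit_iff_isUnit_det, isUnit_iff_ne_zero, not_not,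
      Matrix.det_fin_three]
    simp [Matrix.algebraMap_matrix_apply, sub_eq_zero]
  unfold spectralRadius
  apply le_antisymm
  · refine iSup₂_le fun r hr => ?_
    rcases (key r).1 hr with h | h
    · subst h
      exact (Real.enorm_of_nonneg hx).le
    · subst h
      simp
  · refine le_trans (le_of_eq ?_) (le_iSup₂ (f := fun (r : ℝ) (_ : r ∈ spectrum ℝ
      (!![x, y, z; 0, 0, 0; 0, 0, 0] : Matrix (Fin 3) (Fin 3) ℝ)) => (‖r‖₊ : ENNReal)) x
      ((key x).2 (Or.inl rfl)))
    exact (Real.enorm_of_nonneg hx).symm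

/-- Next-generation matrix computation of the basic reproduction number:
with F = [[0,0,kλ/μ],[0,0,0],[0,0,0]] and
V = [[δ,0,0],[−a, −γ(1−α)+αβ+δ, 0],[0, −αβ, c]],
the matrix V is invertible and the spectral radius of F·V⁻¹ equals
akλαβ/((cαβδ − cγδ + cαγδ + cδ²)μ). -/
theorem hbv_basic_reproduction_number
    (lam μ k δ a β γ c α : ℝ)
    (hlam : 0 < lam) (hμ : 0 < μ) (hk : 0 < k) (hδ : 0 < δ)
    (ha : 0 < a) (hβ : 0 < β) (hγ : 0 < γ) (hc : 0 < c)
    (hα : α ∈ Set.Ioo (0 : ℝ) 1)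
    (hRs : 0 < α * β - (1 - α) * γ + δ)
    (F Vm : Matrix (Fin 3) (Fin 3) ℝ)
    (hF : F = !![0, 0, k * lam / μ; 0, 0, 0; 0, 0, 0])
    (hVm : Vm = !![δ, 0, 0; -a, -γ * (1 - α) + α * β + δ, 0; 0, -(α * β), c]) :
    IsUnit Vm ∧
    spectralRadius ℝ (F * Vm⁻¹) =
      ENNReal.ofReal
        (a * k * lam * α * β /
          ((c * α * β * δ - c * γ * δ + c * α * γ * δ + c * δ ^ 2) * μ)) := by
  obtain ⟨hα0, hα1⟩ := hα
  obtain ⟨s, hs⟩ : ∃ s, s = α * β - (1 - α) * γ + δ := ⟨_, rfl⟩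
  rw [← hs] at hRs
  have e1 : -γ * (1 - α) + α * β + δ = s := by rw [hs]; ring
  have e2 : c * α * β * δ - c * γ * δ + c * α * γ * δ + c * δ ^ 2 = c * δ * s := by
    rw [hs]; ring
  rw [e1] at hVm
  rw [e2]
  clear hs e1 e2
  have hs0 := hRs.ne'
  have hd0 := hδ.ne'
  have hc0 := hc.ne'
  have hm0 := hμ.ne'
  have hmul : Vm * !![1 / δ, 0, 0; a / (δ * s), 1 / s, 0;
      α * β * a / (δ * s * c), α * β / (s * c), 1 / c] = 1 := by
    rw [hVm]
    ext i j
    fin_cases i <;> fin_cases j <;> simp [Matrix.mul_apply, Fin.sum_univ_three] <;>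
      field_simp <;> ring
  refine ⟨IsUnit.of_mul_eq_one _ hmul, ?_⟩
  rw [Matrix.inv_eq_right_inv hmul]
  have hprod : F * !![1 / δ, 0, 0; a / (δ * s), 1 / s, 0;
      α * β * a / (δ * s * c), α * β / (s * c), 1 / c] =
      !![a * k * lam * α * β / (c * δ * s * μ), k * lam / μ * (α * β / (s * c)),
        k * lam / μ * (1 / c); 0, 0, 0; 0, 0, 0] := by
    rw [hF]
    ext i j
    fin_cases i <;> fin_cases j <;> simp [Matrix.mul_apply, Fin.sum_univ_three]
    field_simp
  rw [hprod]
  exact spectralRadius_first_row _ _ _ (by positivity)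
end

section
/- Assume R_s = αβ − (1−α)γ + δ > 0 and R_0 = akλαβ/(cδμR_s) < 1. Then every complex eigenvalue of the Jacobian matrix J_u of the HBV system at the disease-free equilibrium E_u = (λ/μ, 0, 0, 0) has strictly negative real part. -/
/-- Local asymptotic stability of the disease-free equilibrium: if
R_s = αβ − (1−α)γ + δ > 0 and R₀ = akλαβ/(cδμR_s) < 1, then every complex
eigenvalue of the Jacobian of the HBV system at E_u = (λ/μ, 0, 0, 0) has
strictly negative real part. -/
theorem hbv_disease_free_locally_stable
    (lam μ k δ a β γ c α Rs R₀ : ℝ)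
    (hlam : 0 < lam) (hμ : 0 < μ) (hk : 0 < k) (hδ : 0 < δ)
    (ha : 0 < a) (hβ : 0 < β) (hγ : 0 < γ) (hc : 0 < c)
    (hα : α ∈ Set.Ioo (0 : ℝ) 1)
    (hRs : Rs = α * β - (1 - α) * γ + δ)
    (hRspos : 0 < Rs)
    (hR0 : R₀ = a * k * lam * α * β / (c * δ * μ * Rs))
    (hR0lt : R₀ < 1)
    (Ju : Matrix (Fin 4) (Fin 4) ℝ)
    (hJu : Ju = !![-μ, 0, 0, -(k * lam / μ);
                   0, -δ, 0, k * lam / μ;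
                   0, a, γ * (1 - α) - α * β - δ, 0;
                   0, 0, α * β, -c]) :
    ∀ z ∈ spectrum ℂ (Ju.map (Complex.ofReal)), z.re < 0 := by
  intro z hz
  by_contra hre
  have hre : 0 ≤ z.re := not_lt.mp hre
  have key : ∀ x : ℝ, 0 < x → x ≤ ‖z + (x : ℂ)‖ := by
    intro x hx
    have h := Complex.re_le_norm (z + (x : ℂ))
    simp only [Complex.add_re, Complex.ofReal_re] at h
    linarith
  have h33 : γ * (1 - α) - α * β - δ = -Rs := by rw [hRs]; ring
  rw [h33] at hJu
  rw [spectrum.mem_iff, Matrix.isUnit_iff_isUnit_det, isUnit_iff_ne_zero, not_not] at hz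
  have hdet : (z + (μ : ℂ)) * ((z + (δ : ℂ)) * (z + (Rs : ℂ)) * (z + (c : ℂ))
      - ((a * (α * β) * (k * lam / μ) : ℝ) : ℂ)) = 0 := by
    rw [← hz, hJu, Matrix.algebraMap_eq_diagonal]
    simp [Matrix.det_succ_row_zero, Fin.sum_univ_succ, Fin.succAbove, Matrix.diagonal]
    left
    ring
  rcases mul_eq_zero.mp hdet with h | h
  · have h1 := key μ hμ
    rw [h, norm_zero] at h1
    linarith
  · have h2 := congrArg norm (sub_eq_zero.mp h)
    obtain ⟨hα0, hα1⟩ := hα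
    have hp : 0 < a * (α * β) * (k * lam / μ) := by positivity
    rw [norm_mul, norm_mul, Complex.norm_real, Real.norm_of_nonneg hp.le] at h2
    have h3 : δ * Rs * c ≤ ‖z + (δ : ℂ)‖ * ‖z + (Rs : ℂ)‖ * ‖z + (c : ℂ)‖ := by
      have := key δ hδ
      have := key Rs hRspos
      have := key c hc
      gcongr
    rw [hR0, div_lt_one (by positivity)] at hR0lt
    have h4 : a * (α * β) * (k * lam / μ) < δ * Rs * c := by
      have : a * (α * β) * (k * lam / μ) = a * k * lam * α * β / μ := by ring
      rw [this, div_lt_iff₀ hμ]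
      linarith
    linarith
end

section
/- Assume R_s = αβ − (1−α)γ + δ > 0. If R_0 = akλαβ/(cδμR_s) = 1, then the Jacobian matrix J_u of the HBV system at the disease-free equilibrium E_u = (λ/μ, 0, 0, 0) has determinant zero (hence 0 is an eigenvalue); and if R_0 > 1, then J_u has a real eigenvalue that is strictly positive. -/
/-- Instability of the disease-free equilibrium: with R_s = αβ − (1−α)γ + δ > 0
and R₀ = akλαβ/(cδμR_s), if R₀ = 1 then the Jacobian J_u at
E_u = (λ/μ, 0, 0, 0) has determinant zero (hence 0 is an eigenvalue), and if
R₀ > 1 then J_u has a strictly positive real eigenvalue. -/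
theorem hbv_disease_free_critical_and_unstable
    (lam μ k δ a β γ c α Rs R₀ : ℝ)
    (hlam : 0 < lam) (hμ : 0 < μ) (hk : 0 < k) (hδ : 0 < δ)
    (ha : 0 < a) (hβ : 0 < β) (hγ : 0 < γ) (hc : 0 < c)
    (hα : α ∈ Set.Ioo (0 : ℝ) 1)
    (hRs : Rs = α * β - (1 - α) * γ + δ)
    (hRspos : 0 < Rs)
    (hR0 : R₀ = a * k * lam * α * β / (c * δ * μ * Rs))
    (Ju : Matrix (Fin 4) (Fin 4) ℝ)
    (hJu : Ju = !![-μ, 0, 0, -(k * lam / μ);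
                   0, -δ, 0, k * lam / μ;
                   0, a, γ * (1 - α) - α * β - δ, 0;
                   0, 0, α * β, -c]) :
    (R₀ = 1 → Ju.det = 0 ∧ (0 : ℝ) ∈ spectrum ℝ Ju) ∧
    (1 < R₀ → ∃ x : ℝ, 0 < x ∧ x ∈ spectrum ℝ Ju) := by
  obtain ⟨hα0, hα1⟩ := hα
  have hdet : ∀ x : ℝ, (algebraMap ℝ (Matrix (Fin 4) (Fin 4) ℝ) x - Ju).det
      = (x + μ) * ((x + δ) * (x + Rs) * (x + c) - a * (α * β) * (k * lam / μ)) := by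
    intro x
    have hM : algebraMap ℝ (Matrix (Fin 4) (Fin 4) ℝ) x - Ju =
        !![x + μ, 0, 0, k * lam / μ;
           0, x + δ, 0, -(k * lam / μ);
           0, -a, x + Rs, 0;
           0, 0, -(α * β), x + c] := by
      subst hJu hRs
      ext i j
      fin_cases i <;> fin_cases j <;> simp [Matrix.algebraMap_matrix_apply] <;> ring
    rw [hM]
    simp [Matrix.det_succ_row_zero, Fin.sum_univ_succ, Fin.succAbove]
    left
    ring
  have hspec : ∀ x : ℝ, (x + δ) * (x + Rs) * (x + c) - a * (α * β) * (k * lam / μ) = 0 →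
      x ∈ spectrum ℝ Ju := by
    intro x hx
    rw [spectrum.mem_iff, Matrix.isUnit_iff_isUnit_det, hdet x, hx]
    simp
  have hP : a * (α * β) * (k * lam / μ) = R₀ * (δ * Rs * c) := by
    rw [hR0]; field_simp
  have hD : 0 < δ * Rs * c := by positivity
  constructor
  · intro h1
    have h0 : (0 + δ) * (0 + Rs) * (0 + c) - a * (α * β) * (k * lam / μ) = 0 := by
      rw [hP, h1]; ring
    refine ⟨?_, hspec 0 h0⟩
    have h2 := hdet 0
    rw [h0, map_zero, zero_sub, Matrix.det_neg] at h2
    simpa using h2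
  · intro h1
    have hPpos : 0 < a * (α * β) * (k * lam / μ) := by positivity
    have hlt : δ * Rs * c < a * (α * β) * (k * lam / μ) := by
      rw [hP]; nlinarith
    generalize a * (α * β) * (k * lam / μ) = P at *
    have hM : P ≤ (P + 1 + δ) * (P + 1 + Rs) * (P + 1 + c) := by
      have e1 : 1 ≤ (P + 1 + δ) * (P + 1 + Rs) := by
        apply one_le_mul_of_one_le_of_one_le <;> linarith
      nlinarith
    have hcont : ContinuousOn (fun x : ℝ => (x + δ) * (x + Rs) * (x + c) - P)
        (Set.Icc 0 (P + 1)) := by fun_prop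
    obtain ⟨x, hx, hx0⟩ := intermediate_value_Icc (by linarith : (0 : ℝ) ≤ P + 1) hcont
      (show (0 : ℝ) ∈ Set.Icc _ _ from ⟨by simp only [zero_add]; linarith, by linarith⟩)
    refine ⟨x, lt_of_le_of_ne hx.1 ?_, hspec x hx0⟩
    rintro rfl
    simp only [zero_add] at hx0
    linarith
end

section
/- Assume R_s = αβ − (1−α)γ + δ > 0 and R_0 = akλαβ/(cδμR_s) > 1. Write the characteristic polynomial of the Jacobian J_i of the HBV system at the endemic equilibrium E_i = (X₁, Y₁, D₁, V₁) as x⁴ + B₁x³ + B₂x² + B₃x + B₄. Then B₁ > 0, B₂ > 0, B₃ > 0, B₄ > 0, B₁B₂ − B₃ > 0, and B₁B₂B₃ − B₃² − B₁²B₄ > 0 (the Routh–Hurwitz conditions for a quartic). -/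
open Polynomial

/-- Routh–Hurwitz conditions at the endemic equilibrium: if
R_s = αβ − (1−α)γ + δ > 0 and R₀ = akλαβ/(cδμR_s) > 1, and the characteristic
polynomial of the Jacobian J_i at E_i = (X₁, Y₁, D₁, V₁) is written as
x⁴ + B₁x³ + B₂x² + B₃x + B₄, then B₁, B₂, B₃, B₄ > 0, B₁B₂ − B₃ > 0 and
B₁B₂B₃ − B₃² − B₁²B₄ > 0. -/
theorem hbv_routh_hurwitz_endemic
    (lam μ k δ a β γ c α Rs R₀ X₁ Y₁ D₁ V₁ B₁ B₂ B₃ B₄ : ℝ)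
    (hlam : 0 < lam) (hμ : 0 < μ) (hk : 0 < k) (hδ : 0 < δ)
    (ha : 0 < a) (hβ : 0 < β) (hγ : 0 < γ) (hc : 0 < c)
    (hα : α ∈ Set.Ioo (0 : ℝ) 1)
    (hRs : Rs = α * β - (1 - α) * γ + δ)
    (hRspos : 0 < Rs)
    (hR0 : R₀ = a * k * lam * α * β / (c * δ * μ * Rs))
    (hR0gt : 1 < R₀)
    (hX1 : X₁ = c * δ * Rs / (a * α * β * k))
    (hY1 : Y₁ = (a * α * β * k * lam - c * δ * μ * Rs) / (a * α * β * δ * k))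
    (hD1 : D₁ = (a * α * β * k * lam - c * δ * μ * Rs) / (α * β * δ * k * Rs))
    (hV1 : V₁ = (a * α * β * k * lam - c * δ * μ * Rs) / (c * δ * k * Rs))
    (Ji : Matrix (Fin 4) (Fin 4) ℝ)
    (hJi : Ji = !![-μ - k * V₁, 0, 0, -(k * X₁);
                   k * V₁, -δ, 0, k * X₁;
                   0, a, γ * (1 - α) - α * β - δ, 0;
                   0, 0, α * β, -c])
    (hchar : Ji.charpoly =
      X ^ 4 + C B₁ * X ^ 3 + C B₂ * X ^ 2 + C B₃ * X + C B₄) :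
    0 < B₁ ∧ 0 < B₂ ∧ 0 < B₃ ∧ 0 < B₄ ∧
    0 < B₁ * B₂ - B₃ ∧
    0 < B₁ * B₂ * B₃ - B₃ ^ 2 - B₁ ^ 2 * B₄ := by
  obtain ⟨hα0, hα1⟩ := hα
  have hv : 0 < k * V₁ := by
    rw [hR0, lt_div_iff₀ (by positivity)] at hR0gt
    rw [hV1]
    apply mul_pos hk
    apply div_pos
    · linarith
    · positivity
  have hX : a * (α * β) * (k * X₁) = c * δ * Rs := by
    rw [hX1]
    field_simp
  have hR : γ * (1 - α) - α * β - δ = -Rs := by rw [hRs]; ring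
  rw [hR] at hJi
  generalize k * V₁ = v at *
  generalize k * X₁ = w at *
  generalize α * β = b at *
  have key : ∀ x : ℝ, x ^ 4 + B₁ * x ^ 3 + B₂ * x ^ 2 + B₃ * x + B₄
      = (x + (μ + v)) * (x + δ) * (x + Rs) * (x + c) - c * δ * Rs * (x + μ) := by
    intro x
    have h := congrArg (Polynomial.eval x) hchar
    rw [Matrix.eval_charpoly, hJi] at h
    simp [Matrix.det_succ_row_zero, Fin.sum_univ_succ, Fin.succAbove] at h
    rw [← hX]
    linear_combination -h
  have h0 := key 0
  have h1 := key 1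
  have h2 := key (-1)
  have h3 := key 2
  obtain ⟨p, hp⟩ : ∃ p, p = μ + v := ⟨_, rfl⟩
  have hp0 : 0 < p := by linarith
  have e1 : B₁ = p + (δ + Rs + c) := by
    subst hp
    linear_combination h0 / 2 - h1 / 2 - h2 / 6 + h3 / 6
  have e2 : B₂ = p * (δ + Rs + c) + (δ * Rs + δ * c + Rs * c) := by
    subst hp
    linear_combination -h0 + h1 / 2 + h2 / 2
  have e3 : B₃ = p * (δ * Rs + δ * c + Rs * c) := by
    subst hp
    linear_combination -h0 / 2 + h1 - h2 / 3 - h3 / 6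
  have e4 : B₄ = c * δ * Rs * v := by
    linear_combination h0
  have hB1 : 0 < B₁ := by rw [e1]; positivity
  have hB4 : B₁ ^ 2 * B₄ ≤ B₁ ^ 2 * (c * δ * Rs * p) := by
    rw [e4]
    have : v ≤ p := by linarith
    gcongr
  refine ⟨hB1, by rw [e2]; positivity, by rw [e3]; positivity, by rw [e4]; positivity, ?_, ?_⟩
  · rw [e1, e2, e3]
    ring_nf
    positivity
  · refine lt_of_lt_of_le ?_ (sub_le_sub_left hB4 _)
    rw [e1, e2, e3]
    ring_nf
    positivity
end

section
/- Assume R_s = αβ − (1−α)γ + δ > 0 and R_0 = akλαβ/(cδμR_s) > 1. Then every complex eigenvalue of the Jacobian matrix J_i of the HBV system at the endemic equilibrium E_i = (X₁, Y₁, D₁, V₁) has strictly negative real part; i.e. the endemic equilibrium is locally asymptotically stable. -/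
/-- Local asymptotic stability of the endemic equilibrium: if
R_s = αβ − (1−α)γ + δ > 0 and R₀ = akλαβ/(cδμR_s) > 1, then every complex
eigenvalue of the Jacobian of the HBV system at the endemic equilibrium
E_i = (X₁, Y₁, D₁, V₁) has strictly negative real part. -/
theorem hbv_endemic_locally_stable
    (lam μ k δ a β γ c α Rs R₀ X₁ Y₁ D₁ V₁ : ℝ)
    (hlam : 0 < lam) (hμ : 0 < μ) (hk : 0 < k) (hδ : 0 < δ)
    (ha : 0 < a) (hβ : 0 < β) (hγ : 0 < γ) (hc : 0 < c)
    (hα : α ∈ Set.Ioo (0 : ℝ) 1)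
    (hRs : Rs = α * β - (1 - α) * γ + δ)
    (hRspos : 0 < Rs)
    (hR0 : R₀ = a * k * lam * α * β / (c * δ * μ * Rs))
    (hR0gt : 1 < R₀)
    (hX1 : X₁ = c * δ * Rs / (a * α * β * k))
    (hY1 : Y₁ = (a * α * β * k * lam - c * δ * μ * Rs) / (a * α * β * δ * k))
    (hD1 : D₁ = (a * α * β * k * lam - c * δ * μ * Rs) / (α * β * δ * k * Rs))
    (hV1 : V₁ = (a * α * β * k * lam - c * δ * μ * Rs) / (c * δ * k * Rs))
    (Ji : Matrix (Fin 4) (Fin 4) ℝ)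
    (hJi : Ji = !![-μ - k * V₁, 0, 0, -(k * X₁);
                   k * V₁, -δ, 0, k * X₁;
                   0, a, γ * (1 - α) - α * β - δ, 0;
                   0, 0, α * β, -c]) :
    ∀ z ∈ spectrum ℂ (Ji.map (Complex.ofReal)), z.re < 0 := by
  intro z hz
  obtain ⟨hα0, hα1⟩ := hα
  have hden : 0 < c * δ * μ * Rs := by positivity
  have hp : 0 < k * V₁ := by
    rw [hR0, lt_div_iff₀ hden] at hR0gt
    have : 0 < V₁ := by
      rw [hV1]
      apply div_pos _ (by positivity)
      linarith
    positivity
  have hX : a * (α * β) * (k * X₁) = c * δ * Rs := by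
    rw [hX1]
    field_simp
  generalize k * V₁ = p at *
  generalize k * X₁ = q at *
  have hRs' : γ * (1 - α) - α * β - δ = -Rs := by rw [hRs]; ring
  rw [hRs'] at hJi
  generalize hb : α * β = b at *
  have hdet : (algebraMap ℂ (Matrix (Fin 4) (Fin 4) ℂ) z - Ji.map Complex.ofReal).det = 0 := by
    rw [spectrum.mem_iff, Matrix.isUnit_iff_isUnit_det, isUnit_iff_ne_zero, not_not] at hz
    exact hz
  have hXc : (a : ℂ) * b * q = c * δ * Rs := by exact_mod_cast hX
  have hchar : (z + ((μ + p : ℝ) : ℂ)) * ((z + (δ : ℂ)) * (z + (Rs : ℂ)) * (z + (c : ℂ)))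
      = ((c * δ * Rs : ℝ) : ℂ) * (z + (μ : ℂ)) := by
    have e : (algebraMap ℂ (Matrix (Fin 4) (Fin 4) ℂ) z - Ji.map Complex.ofReal)
        = !![z + μ + p, 0, 0, (q : ℂ);
             -(p : ℂ), z + δ, 0, -(q : ℂ);
             0, -(a : ℂ), z + Rs, 0;
             0, 0, -(b : ℂ), z + c] := by
      rw [hJi]
      ext i j
      fin_cases i <;> fin_cases j <;> simp [Matrix.algebraMap_matrix_apply] <;> ring
    rw [e] at hdet
    simp [Matrix.det_succ_row_zero, Fin.sum_univ_succ, Fin.succAbove] at hdet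
    push_cast
    linear_combination hdet + (z + μ) * hXc
  by_contra hre
  push Not at hre
  have hle : ∀ r : ℝ, 0 < r → r ≤ ‖z + (r : ℂ)‖ := by
    intro r hr
    have := Complex.re_le_norm (z + (r : ℂ))
    simp at this
    linarith
  have hlt : ‖z + (μ : ℂ)‖ < ‖z + ((μ + p : ℝ) : ℂ)‖ := by
    rw [Complex.norm_def, Complex.norm_def]
    apply Real.sqrt_lt_sqrt (Complex.normSq_nonneg _)
    simp only [Complex.normSq_apply, Complex.add_re, Complex.add_im, Complex.ofReal_re,
      Complex.ofReal_im]
    nlinarith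
  have hn := congrArg norm hchar
  rw [norm_mul, norm_mul, norm_mul, norm_mul, Complex.norm_real,
    Real.norm_of_nonneg (by positivity)] at hn
  have h3 : δ * Rs * c ≤ ‖z + (δ : ℂ)‖ * ‖z + (Rs : ℂ)‖ * ‖z + (c : ℂ)‖ := by
    gcongr
    · exact hle δ hδ
    · exact hle Rs hRspos
    · exact hle c hc
  have h4 : 0 < δ * Rs * c := by positivity
  have h5 := mul_le_mul_of_nonneg_left h3 (norm_nonneg (z + ((μ + p : ℝ) : ℂ)))
  have h6 := mul_lt_mul_of_pos_right hlt h4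
  nlinarith
end

section
/- Assume R_s = αβ − (1−α)γ + δ > 0 and let X₀ = λ/μ. Along any solution of the HBV system with X(t) > 0, Y(t) ≥ 0, D(t) ≥ 0, V(t) ≥ 0, the Lyapunov function L₁(t) = X₀(X(t)/X₀ − 1 − ln(X(t)/X₀)) + Y(t) + (δ/a)D(t) + (δR_s/(aαβ))V(t) satisfies dL₁/dt = λ(2 − X/X₀ − X₀/X) + ((aαβkλ − cδμR_s)/(aαβμ))·V; in particular, if R_0 = akλαβ/(cδμR_s) ≤ 1 then dL₁/dt ≤ 0 for all t. -/
/-- Derivative of the Lyapunov function L₁ along solutions of the HBV system: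
with X₀ = λ/μ and R_s = αβ − (1−α)γ + δ > 0, along any solution with
X(t) > 0 and Y(t), D(t), V(t) ≥ 0,
L₁(t) = X₀(X/X₀ − 1 − ln(X/X₀)) + Y + (δ/a)D + (δR_s/(aαβ))V satisfies
dL₁/dt = λ(2 − X/X₀ − X₀/X) + ((aαβkλ − cδμR_s)/(aαβμ))·V; in particular,
if R₀ = akλαβ/(cδμR_s) ≤ 1 then dL₁/dt ≤ 0. -/
theorem hbv_lyapunov_disease_free
    (lam μ k δ a β γ c α Rs R₀ X₀ : ℝ)
    (hlam : 0 < lam) (hμ : 0 < μ) (hk : 0 < k) (hδ : 0 < δ)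
    (ha : 0 < a) (hβ : 0 < β) (hγ : 0 < γ) (hc : 0 < c)
    (hα : α ∈ Set.Ioo (0 : ℝ) 1)
    (hRs : Rs = α * β - (1 - α) * γ + δ)
    (hRspos : 0 < Rs)
    (hR0 : R₀ = a * k * lam * α * β / (c * δ * μ * Rs))
    (hX0 : X₀ = lam / μ)
    (X Y D V : ℝ → ℝ)
    (hX : ∀ t, HasDerivAt X (lam - μ * X t - k * V t * X t) t)
    (hY : ∀ t, HasDerivAt Y (k * V t * X t - δ * Y t) t)
    (hD : ∀ t, HasDerivAt D (a * Y t + γ * (1 - α) * D t - α * β * D t - δ * D t) t)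
    (hV : ∀ t, HasDerivAt V (α * β * D t - c * V t) t)
    (hXpos : ∀ t, 0 < X t)
    (hYpos : ∀ t, 0 ≤ Y t) (hDpos : ∀ t, 0 ≤ D t) (hVpos : ∀ t, 0 ≤ V t) :
    (∀ t, HasDerivAt
        (fun s => X₀ * (X s / X₀ - 1 - Real.log (X s / X₀)) + Y s +
          (δ / a) * D s + (δ * Rs / (a * α * β)) * V s)
        (lam * (2 - X t / X₀ - X₀ / X t) +
          ((a * α * β * k * lam - c * δ * μ * Rs) / (a * α * β * μ)) * V t) t) ∧
    (R₀ ≤ 1 →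
      ∀ t, lam * (2 - X t / X₀ - X₀ / X t) +
        ((a * α * β * k * lam - c * δ * μ * Rs) / (a * α * β * μ)) * V t ≤ 0) := by
  obtain ⟨hα0, hα1⟩ := hα
  have hX0pos : 0 < X₀ := by rw [hX0]; positivity
  constructor
  · intro t
    have hx := hXpos t
    have h1 := (hX t).div_const X₀
    have h2 := h1.log (div_pos hx hX0pos).ne'
    have h := ((((h1.sub_const 1).sub h2).const_mul X₀).add (hY t)).add
      ((hD t).const_mul (δ / a)) |>.add ((hV t).const_mul (δ * Rs / (a * α * β)))
    refine h.congr_deriv ?_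
    have hx' := hx.ne'
    have hRs' : γ = (α * β + δ - Rs) / (1 - α) := by
      have : 1 - α ≠ 0 := by linarith
      field_simp
      linarith
    have h1α : 1 - α ≠ 0 := by linarith
    rw [hX0, hRs']
    field_simp
    ring
  · intro hR t
    have hx := hXpos t
    have hden : 0 < c * δ * μ * Rs := by positivity
    rw [hR0, div_le_one hden] at hR
    have hA : X t / X₀ + X₀ / X t - 2 = (X t - X₀) ^ 2 / (X t * X₀) := by
      field_simp
      ring
    have hA' : 0 ≤ (X t - X₀) ^ 2 / (X t * X₀) := by positivity
    have h1 : lam * (2 - X t / X₀ - X₀ / X t) ≤ 0 :=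
      mul_nonpos_of_nonneg_of_nonpos hlam.le (by linarith)
    have h2 : (a * α * β * k * lam - c * δ * μ * Rs) / (a * α * β * μ) * V t ≤ 0 :=
      mul_nonpos_of_nonpos_of_nonneg
        (div_nonpos_of_nonpos_of_nonneg (by linarith) (by positivity)) (hVpos t)
    linarith
end

section
/- Assume R_s = αβ − (1−α)γ + δ > 0 and R_0 = akλαβ/(cδμR_s) > 1, and let (X₁, Y₁, D₁, V₁) be the endemic equilibrium. Along any solution of the HBV system with X(t), Y(t), D(t), V(t) > 0, the Lyapunov function L₂(t) = X₁(X/X₁ − 1 − ln(X/X₁)) + Y₁(Y/Y₁ − 1 − ln(Y/Y₁)) + (δD₁/a)(D/D₁ − 1 − ln(D/D₁)) + (δR_sV₁/(aαβ))(V/V₁ − 1 − ln(V/V₁)) satisfies dL₂/dt = −μX(1 − X₁/X)² + δY₁(4 − (Y·D₁)/(D·Y₁) − (D·V₁)/(D₁·V) − (X·Y₁·V)/(X₁·Y·V₁) − X₁/X), and consequently dL₂/dt ≤ 0 for all t. -/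
/-- Derivative of one Volterra-type term. -/
theorem volterra_deriv (f : ℝ → ℝ) (f' C A t : ℝ) (hA : 0 < A) (hp : 0 < f t)
    (hf : HasDerivAt f f' t) :
    HasDerivAt (fun s => C * (f s / A - 1 - Real.log (f s / A)))
      (C * (f' / A - f' / f t)) t := by
  have h1 : HasDerivAt (fun s => f s / A) (f' / A) t := hf.div_const A
  have h2 := h1.log (div_pos hp hA).ne'
  have h3 := ((h1.sub_const 1).sub h2).const_mul C
  refine HasDerivAt.congr_deriv h3 ?_
  have := hp.ne'
  field_simp

/-- AM-GM for four positive numbers with product one. -/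
theorem four_amgm (p q r s : ℝ) (hp : 0 < p) (hq : 0 < q) (hr : 0 < r) (hs : 0 < s)
    (h : p * q * r * s = 1) : 4 - p - q - r - s ≤ 0 := by
  have e : Real.log p + Real.log q + Real.log r + Real.log s = 0 := by
    rw [← Real.log_mul hp.ne' hq.ne', ← Real.log_mul (by positivity) hr.ne',
      ← Real.log_mul (by positivity) hs.ne', h, Real.log_one]
  linarith [Real.log_le_sub_one_of_pos hp, Real.log_le_sub_one_of_pos hq,
    Real.log_le_sub_one_of_pos hr, Real.log_le_sub_one_of_pos hs]

/-- Derivative of the Lyapunov function L₂ along solutions of the HBV system: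
with R_s = αβ − (1−α)γ + δ > 0, R₀ = akλαβ/(cδμR_s) > 1 and
(X₁, Y₁, D₁, V₁) the endemic equilibrium, along any positive solution,
L₂(t) = X₁(X/X₁ − 1 − ln(X/X₁)) + Y₁(Y/Y₁ − 1 − ln(Y/Y₁))
        + (δD₁/a)(D/D₁ − 1 − ln(D/D₁)) + (δR_sV₁/(aαβ))(V/V₁ − 1 − ln(V/V₁))
satisfies dL₂/dt = −μX(1 − X₁/X)² + δY₁(4 − YD₁/(DY₁) − DV₁/(D₁V)
− XY₁V/(X₁YV₁) − X₁/X), and consequently dL₂/dt ≤ 0. -/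
theorem hbv_lyapunov_endemic
    (lam μ k δ a β γ c α Rs R₀ X₁ Y₁ D₁ V₁ : ℝ)
    (hlam : 0 < lam) (hμ : 0 < μ) (hk : 0 < k) (hδ : 0 < δ)
    (ha : 0 < a) (hβ : 0 < β) (hγ : 0 < γ) (hc : 0 < c)
    (hα : α ∈ Set.Ioo (0 : ℝ) 1)
    (hRs : Rs = α * β - (1 - α) * γ + δ)
    (hRspos : 0 < Rs)
    (hR0 : R₀ = a * k * lam * α * β / (c * δ * μ * Rs))
    (hR0gt : 1 < R₀)
    (hX1 : X₁ = c * δ * Rs / (a * α * β * k))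
    (hY1 : Y₁ = (a * α * β * k * lam - c * δ * μ * Rs) / (a * α * β * δ * k))
    (hD1 : D₁ = (a * α * β * k * lam - c * δ * μ * Rs) / (α * β * δ * k * Rs))
    (hV1 : V₁ = (a * α * β * k * lam - c * δ * μ * Rs) / (c * δ * k * Rs))
    (X Y D V : ℝ → ℝ)
    (hX : ∀ t, HasDerivAt X (lam - μ * X t - k * V t * X t) t)
    (hY : ∀ t, HasDerivAt Y (k * V t * X t - δ * Y t) t)
    (hD : ∀ t, HasDerivAt D (a * Y t + γ * (1 - α) * D t - α * β * D t - δ * D t) t)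
    (hV : ∀ t, HasDerivAt V (α * β * D t - c * V t) t)
    (hXpos : ∀ t, 0 < X t) (hYpos : ∀ t, 0 < Y t)
    (hDpos : ∀ t, 0 < D t) (hVpos : ∀ t, 0 < V t) :
    (∀ t, HasDerivAt
        (fun s => X₁ * (X s / X₁ - 1 - Real.log (X s / X₁)) +
          Y₁ * (Y s / Y₁ - 1 - Real.log (Y s / Y₁)) +
          (δ * D₁ / a) * (D s / D₁ - 1 - Real.log (D s / D₁)) +
          (δ * Rs * V₁ / (a * α * β)) * (V s / V₁ - 1 - Real.log (V s / V₁)))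
        (-(μ * X t) * (1 - X₁ / X t) ^ 2 +
          δ * Y₁ * (4 - (Y t * D₁) / (D t * Y₁) - (D t * V₁) / (D₁ * V t) -
            (X t * Y₁ * V t) / (X₁ * Y t * V₁) - X₁ / X t)) t) ∧
    (∀ t, -(μ * X t) * (1 - X₁ / X t) ^ 2 +
        δ * Y₁ * (4 - (Y t * D₁) / (D t * Y₁) - (D t * V₁) / (D₁ * V t) -
          (X t * Y₁ * V t) / (X₁ * Y t * V₁) - X₁ / X t) ≤ 0) := by
  have hα0 : 0 < α := hα.1
  have hN : 0 < a * α * β * k * lam - c * δ * μ * Rs := by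
    rw [hR0, lt_div_iff₀ (by positivity)] at hR0gt
    linarith
  have pX : 0 < X₁ := by rw [hX1]; positivity
  have pY : 0 < Y₁ := by rw [hY1]; exact div_pos hN (by positivity)
  have pD : 0 < D₁ := by rw [hD1]; exact div_pos hN (by positivity)
  have pV : 0 < V₁ := by rw [hV1]; exact div_pos hN (by positivity)
  have ek : k = δ * Y₁ / (X₁ * V₁) := by
    rw [eq_div_iff (by positivity), hX1, hY1, hV1]; field_simp
  have eR : Rs = a * Y₁ / D₁ := by
    rw [eq_div_iff (by positivity), hD1, hY1]; field_simp
  have ec : c = α * β * D₁ / V₁ := by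
    rw [eq_div_iff (by positivity), hD1, hV1]; field_simp
  have el : lam = μ * X₁ + δ * Y₁ := by
    rw [hX1, hY1]; field_simp; ring
  clear hX1 hY1 hD1 hV1 hR0 hR0gt hN
  refine ⟨fun t => ?_, fun t => ?_⟩
  · have x := hXpos t
    have y := hYpos t
    have d := hDpos t
    have v := hVpos t
    have hD' : HasDerivAt D (a * Y t - Rs * D t) t := by
      convert hD t using 1
      rw [hRs]; ring
    have H := (((volterra_deriv X _ X₁ X₁ t pX x (hX t)).add
      (volterra_deriv Y _ Y₁ Y₁ t pY y (hY t))).add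
      (volterra_deriv D _ (δ * D₁ / a) D₁ t pD d hD')).add
      (volterra_deriv V _ (δ * Rs * V₁ / (a * α * β)) V₁ t pV v (hV t))
    refine H.congr_deriv ?_
    clear H hD' hRs
    rw [ek, eR, ec, el]
    generalize X t = x' at *
    generalize Y t = y' at *
    generalize D t = d' at *
    generalize V t = v' at *
    field_simp
    ring
  · have x := hXpos t
    have y := hYpos t
    have d := hDpos t
    have v := hVpos t
    have h := four_amgm ((Y t * D₁) / (D t * Y₁)) ((D t * V₁) / (D₁ * V t))
      ((X t * Y₁ * V t) / (X₁ * Y t * V₁)) (X₁ / X t) (by positivity) (by positivity)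
      (by positivity) (by positivity) (by field_simp)
    have h1 := mul_nonpos_of_nonneg_of_nonpos (mul_pos hδ pY).le h
    have h2 : 0 ≤ (μ * X t) * (1 - X₁ / X t) ^ 2 := by positivity
    linarith
end

section
/- Assume R_s = αβ − (1−α)γ + δ > 0 and R_0 = akλαβ/(cδμR_s) ≤ 1. Then the disease-free equilibrium E_u = (λ/μ, 0, 0, 0) is globally asymptotically stable: every solution of the HBV system with X(0) > 0 and Y(0), D(0), V(0) ≥ 0 satisfies (X(t), Y(t), D(t), V(t)) → (λ/μ, 0, 0, 0) as t → ∞. -/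
open Filter

/-- Barbalat-type lemma. -/
lemma aux_barbalat (f g h : ℝ → ℝ) (l M : ℝ)
    (hf : ∀ t, 0 ≤ t → HasDerivAt f (g t) t)
    (hg : ∀ t, 0 ≤ t → HasDerivAt g (h t) t)
    (hM : ∀ t, 0 ≤ t → |h t| ≤ M)
    (hl : Tendsto f atTop (nhds l)) : Tendsto g atTop (nhds 0) := by
  have hM0 : 0 ≤ M := (abs_nonneg _).trans (hM 0 le_rfl)
  rw [Metric.tendsto_atTop]
  intro ε hε
  set s : ℝ := ε / (2 * (M + 1)) with hs
  have hspos : 0 < s := by positivity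
  have hMs : M * s < ε / 2 := by
    have : (M + 1) * s = ε / 2 := by rw [hs]; field_simp
    nlinarith
  have hlim : Tendsto (fun t => f (t + s) - f t) atTop (nhds (l - l)) :=
    (hl.comp (tendsto_atTop_add_const_right atTop s tendsto_id)).sub hl
  rw [sub_self, Metric.tendsto_atTop] at hlim
  obtain ⟨N, hN⟩ := hlim (s * (ε / 2)) (by positivity)
  refine ⟨max N 0, fun t ht => ?_⟩
  have htN : N ≤ t := (le_max_left _ _).trans ht
  have ht0 : 0 ≤ t := (le_max_right _ _).trans ht
  have h1 := hN t htN
  rw [Real.dist_eq, sub_zero] at h1 ⊢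
  obtain ⟨ξ, hξ, hξe⟩ := exists_hasDerivAt_eq_slope f g (show t < t + s by linarith)
    (fun x hx => (hf x (ht0.trans hx.1)).continuousAt.continuousWithinAt)
    (fun x hx => hf x (ht0.trans hx.1.le))
  obtain ⟨η, hη, hηe⟩ := exists_hasDerivAt_eq_slope g h hξ.1
    (fun x hx => (hg x (ht0.trans hx.1)).continuousAt.continuousWithinAt)
    (fun x hx => hg x (ht0.trans hx.1.le))
  have hx0 : 0 < ξ - t := by linarith [hξ.1]
  have hxs : ξ - t ≤ s := by linarith [hξ.2]
  rw [eq_div_iff hx0.ne'] at hηe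
  rw [add_sub_cancel_left, eq_div_iff hspos.ne'] at hξe
  have h2 : |g ξ - g t| ≤ M * s := by
    rw [← hηe, abs_mul, abs_of_pos hx0]
    exact mul_le_mul (hM η (ht0.trans hη.1.le)) hxs hx0.le hM0
  have h3 : |g ξ| < ε / 2 := by
    rw [← hξe, abs_mul, abs_of_pos hspos, mul_comm] at h1
    exact lt_of_mul_lt_mul_left h1 hspos.le
  rw [abs_le] at h2
  rw [abs_lt] at h3 ⊢
  constructor <;> linarith [h2.1, h2.2, h3.1, h3.2]

lemma aux_min_sq (x : ℝ) : HasDerivAt (fun x : ℝ => (min x 0) ^ 2) (2 * min x 0) x := by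
  rcases lt_trichotomy x 0 with hx | hx | hx
  · rw [min_eq_left hx.le]
    have h : HasDerivAt (fun y : ℝ => y ^ 2) (2 * x) x := by
      simpa using hasDerivAt_pow 2 x
    refine h.congr_of_eventuallyEq ?_
    filter_upwards [Iio_mem_nhds hx] with y hy
    rw [min_eq_left (le_of_lt hy)]
  · subst hx
    rw [hasDerivAt_iff_isLittleO_nhds_zero]
    have h1 : (fun h : ℝ => h ^ 2) =o[nhds 0] fun h : ℝ => h := by
      simpa using Asymptotics.isLittleO_pow_pow (𝕜 := ℝ) (show 1 < 2 by norm_num)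
    refine Asymptotics.IsBigO.trans_isLittleO ?_ h1
    refine Asymptotics.IsBigO.of_bound 1 (Eventually.of_forall fun y => ?_)
    simp only [zero_add, min_self, smul_eq_mul, mul_zero, sub_zero, Real.norm_eq_abs, one_mul]
    rcases le_total y 0 with hy | hy
    · simp [min_eq_left hy]
    · simp [min_eq_right hy]; positivity
  · rw [min_eq_right hx.le, mul_zero]
    refine (hasDerivAt_const x (0 : ℝ)).congr_of_eventuallyEq ?_
    filter_upwards [Ioi_mem_nhds hx] with y hy
    rw [min_eq_right (le_of_lt hy)]; norm_num

lemma aux_nonneg (δ a r p c : ℝ) (hδ : 0 < δ) (ha : 0 < a) (hr : 0 < r) (hp : 0 < p) (hc : 0 < c)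
    (q Y D V : ℝ → ℝ) (hqc : Continuous q) (hq : ∀ t, 0 ≤ t → 0 ≤ q t)
    (hY : ∀ t, HasDerivAt Y (q t * V t - δ * Y t) t)
    (hD : ∀ t, HasDerivAt D (a * Y t - r * D t) t)
    (hV : ∀ t, HasDerivAt V (p * D t - c * V t) t)
    (hY0 : 0 ≤ Y 0) (hD0 : 0 ≤ D 0) (hV0 : 0 ≤ V 0) (T : ℝ) (hT : 0 ≤ T) :
    0 ≤ Y T ∧ 0 ≤ D T ∧ 0 ≤ V T := by
  obtain ⟨Q, hQ⟩ := (isCompact_Icc (a := (0 : ℝ)) (b := T)).exists_bound_of_continuousOn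
    hqc.continuousOn
  set C := Q + a + p with hC
  let W : ℝ → ℝ := fun t =>
    ((min (Y t) 0) ^ 2 + (min (D t) 0) ^ 2 + (min (V t) 0) ^ 2) * Real.exp (-C * t)
  have hW : ∀ t, HasDerivAt W
      ((2 * min (Y t) 0 * (q t * V t - δ * Y t) + 2 * min (D t) 0 * (a * Y t - r * D t)
        + 2 * min (V t) 0 * (p * D t - c * V t)) * Real.exp (-C * t)
        + ((min (Y t) 0) ^ 2 + (min (D t) 0) ^ 2 + (min (V t) 0) ^ 2)
          * (Real.exp (-C * t) * -C)) t := by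
    intro t
    have e : HasDerivAt (fun t => Real.exp (-C * t)) (Real.exp (-C * t) * -C) t := by
      simpa using ((hasDerivAt_id t).const_mul (-C)).exp
    exact ((((aux_min_sq (Y t)).comp t (hY t)).add ((aux_min_sq (D t)).comp t (hD t))).add
      ((aux_min_sq (V t)).comp t (hV t))).mul e
  have anti : AntitoneOn W (Set.Icc 0 T) := by
    refine antitoneOn_of_deriv_nonpos (convex_Icc 0 T)
      (fun t _ => (hW t).continuousAt.continuousWithinAt)
      (fun t _ => (hW t).differentiableAt.differentiableWithinAt) ?_
    intro t ht
    rw [interior_Icc] at ht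
    rw [(hW t).deriv]
    have hqQ : q t ≤ Q := (le_abs_self _).trans (hQ t ⟨ht.1.le, ht.2.le⟩)
    have hq0 := hq t ht.1.le
    have key : ∀ x : ℝ, ∃ m, min x 0 = m ∧ m ≤ 0 ∧ m ≤ x ∧ m * x = m ^ 2 := by
      intro x
      refine ⟨_, rfl, min_le_right _ _, min_le_left _ _, ?_⟩
      rcases le_total x 0 with h | h
      · rw [min_eq_left h]; ring
      · rw [min_eq_right h]; ring
    obtain ⟨y, ey, y0, yY, yy⟩ := key (Y t)
    obtain ⟨d, ed, d0, dD, dd⟩ := key (D t)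
    obtain ⟨v, ev, v0, vV, vv⟩ := key (V t)
    rw [ey, ed, ev]
    have i1 : q t * (y * V t) ≤ q t * (y * v) :=
      mul_le_mul_of_nonneg_left (mul_le_mul_of_nonpos_left vV y0) hq0
    have i1' : q t * (2 * (y * v)) ≤ Q * (y ^ 2 + v ^ 2) := by
      have : 2 * (y * v) ≤ y ^ 2 + v ^ 2 := by nlinarith [sq_nonneg (y - v)]
      calc _ ≤ q t * (y ^ 2 + v ^ 2) := mul_le_mul_of_nonneg_left this hq0
        _ ≤ _ := mul_le_mul_of_nonneg_right hqQ (by positivity)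
    have i2 : a * (d * Y t) ≤ a * (d * y) :=
      mul_le_mul_of_nonneg_left (mul_le_mul_of_nonpos_left yY d0) ha.le
    have i2' : a * (2 * (d * y)) ≤ a * (d ^ 2 + y ^ 2) :=
      mul_le_mul_of_nonneg_left (by nlinarith [sq_nonneg (d - y)]) ha.le
    have i3 : p * (v * D t) ≤ p * (v * d) :=
      mul_le_mul_of_nonneg_left (mul_le_mul_of_nonpos_left dD v0) hp.le
    have i3' : p * (2 * (v * d)) ≤ p * (v ^ 2 + d ^ 2) :=
      mul_le_mul_of_nonneg_left (by nlinarith [sq_nonneg (v - d)]) hp.le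
    have hQ0 : 0 ≤ Q := hq0.trans hqQ
    have n1 : 0 ≤ δ * y ^ 2 := by positivity
    have n2 : 0 ≤ r * d ^ 2 := by positivity
    have n3 : 0 ≤ c * v ^ 2 := by positivity
    have n4 : 0 ≤ Q * d ^ 2 := by positivity
    have n5 : 0 ≤ a * v ^ 2 := by positivity
    have n6 : 0 ≤ p * y ^ 2 := by positivity
    have main : 2 * y * (q t * V t - δ * Y t) + 2 * d * (a * Y t - r * D t)
        + 2 * v * (p * D t - c * V t) - C * (y ^ 2 + d ^ 2 + v ^ 2) ≤ 0 := by
      have e : 2 * y * (q t * V t - δ * Y t) + 2 * d * (a * Y t - r * D t)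
        + 2 * v * (p * D t - c * V t) = 2 * (q t * (y * V t)) - 2 * (δ * (y * Y t))
          + 2 * (a * (d * Y t)) - 2 * (r * (d * D t)) + 2 * (p * (v * D t))
          - 2 * (c * (v * V t)) := by ring
      rw [e, yy, dd, vv, hC]
      linarith
    have := mul_nonpos_of_nonpos_of_nonneg main (Real.exp_pos (-C * t)).le
    linarith
  have hle := anti (Set.left_mem_Icc.2 hT) (Set.right_mem_Icc.2 hT) hT
  simp only [W, min_eq_right hY0, min_eq_right hD0, min_eq_right hV0] at hle
  have hle2 : (min (Y T) 0) ^ 2 + (min (D T) 0) ^ 2 + (min (V T) 0) ^ 2 ≤ 0 := by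
    by_contra hcon
    push Not at hcon
    have := mul_pos hcon (Real.exp_pos (-C * T))
    norm_num at hle this
    linarith
  have n1 := sq_nonneg (min (Y T) 0)
  have n2 := sq_nonneg (min (D T) 0)
  have n3 := sq_nonneg (min (V T) 0)
  have z : ∀ x : ℝ, (min x 0) ^ 2 ≤ 0 → 0 ≤ x := by
    intro x hx
    have : min x 0 = 0 := by nlinarith [sq_nonneg (min x 0), pow_eq_zero_iff (two_ne_zero) |>.1 (le_antisymm hx (sq_nonneg (min x 0)))]
    exact min_eq_right_iff.1 this
  exact ⟨z _ (by linarith), z _ (by linarith), z _ (by linarith)⟩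

lemma aux_pos (lam μ k : ℝ) (hlam : 0 < lam) (X V : ℝ → ℝ) (hVc : Continuous V)
    (hX : ∀ t, HasDerivAt X (lam - μ * X t - k * V t * X t) t) (hX0 : 0 < X 0)
    (t : ℝ) (ht : 0 ≤ t) : 0 < X t := by
  let A : ℝ → ℝ := fun t => ∫ s in (0 : ℝ)..t, (μ + k * V s)
  have hc : Continuous fun s => μ + k * V s := by fun_prop
  have hA : ∀ t, HasDerivAt A (μ + k * V t) t := fun t =>
    intervalIntegral.integral_hasDerivAt_right (hc.intervalIntegrable _ _)
      (hc.stronglyMeasurableAtFilter _ _) hc.continuousAt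
  have hP : ∀ t, HasDerivAt (fun t => X t * Real.exp (A t)) (lam * Real.exp (A t)) t := by
    intro t
    refine ((hX t).mul (hA t).exp).congr_deriv ?_
    ring
  have mono : Monotone (fun t => X t * Real.exp (A t)) :=
    monotone_of_deriv_nonneg (fun t => (hP t).differentiableAt)
      (fun t => by rw [(hP t).deriv]; positivity)
  have h := mono ht
  have h0 : 0 < X 0 * Real.exp (A 0) := by positivity
  exact pos_of_mul_pos_left (h0.trans_le h) (Real.exp_pos _).le

/-- Bounded on the nonnegative half-line. -/
def AuxBdd (f : ℝ → ℝ) : Prop := ∃ C, ∀ t, 0 ≤ t → |f t| ≤ C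

lemma AuxBdd.const (r : ℝ) : AuxBdd fun _ => r := ⟨|r|, fun _ _ => le_rfl⟩

lemma AuxBdd.add {f g : ℝ → ℝ} (hf : AuxBdd f) (hg : AuxBdd g) : AuxBdd fun t => f t + g t := by
  obtain ⟨A, hA⟩ := hf
  obtain ⟨B, hB⟩ := hg
  exact ⟨A + B, fun t ht => (abs_add_le _ _).trans (add_le_add (hA t ht) (hB t ht))⟩

lemma AuxBdd.mul {f g : ℝ → ℝ} (hf : AuxBdd f) (hg : AuxBdd g) : AuxBdd fun t => f t * g t := by
  obtain ⟨A, hA⟩ := hf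
  obtain ⟨B, hB⟩ := hg
  refine ⟨A * B, fun t ht => ?_⟩
  rw [abs_mul]
  exact mul_le_mul (hA t ht) (hB t ht) (abs_nonneg _) ((abs_nonneg _).trans (hA t ht))

lemma AuxBdd.sub {f g : ℝ → ℝ} (hf : AuxBdd f) (hg : AuxBdd g) : AuxBdd fun t => f t - g t := by
  obtain ⟨A, hA⟩ := hf
  obtain ⟨B, hB⟩ := hg
  exact ⟨A + B, fun t ht => (abs_sub _ _).trans (add_le_add (hA t ht) (hB t ht))⟩

lemma AuxBdd.barbalat {f g h : ℝ → ℝ} {l : ℝ} (hM : AuxBdd h)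
    (hf : ∀ t, 0 ≤ t → HasDerivAt f (g t) t)
    (hg : ∀ t, 0 ≤ t → HasDerivAt g (h t) t)
    (hl : Tendsto f atTop (nhds l)) : Tendsto g atTop (nhds 0) := by
  obtain ⟨M, hM⟩ := hM
  exact aux_barbalat f g h l M hf hg hM hl

/-- Global asymptotic stability of the disease-free equilibrium: if
R_s = αβ − (1−α)γ + δ > 0 and R₀ = akλαβ/(cδμR_s) ≤ 1, then every solution of
the HBV system with X(0) > 0 and Y(0), D(0), V(0) ≥ 0 converges to
E_u = (λ/μ, 0, 0, 0) as t → ∞. -/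
theorem hbv_disease_free_globally_stable
    (lam μ k δ a β γ c α Rs R₀ : ℝ)
    (hlam : 0 < lam) (hμ : 0 < μ) (hk : 0 < k) (hδ : 0 < δ)
    (ha : 0 < a) (hβ : 0 < β) (hγ : 0 < γ) (hc : 0 < c)
    (hα : α ∈ Set.Ioo (0 : ℝ) 1)
    (hRs : Rs = α * β - (1 - α) * γ + δ)
    (hRspos : 0 < Rs)
    (hR0 : R₀ = a * k * lam * α * β / (c * δ * μ * Rs))
    (hR0le : R₀ ≤ 1)
    (X Y D V : ℝ → ℝ)
    (hX : ∀ t, HasDerivAt X (lam - μ * X t - k * V t * X t) t)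
    (hY : ∀ t, HasDerivAt Y (k * V t * X t - δ * Y t) t)
    (hD : ∀ t, HasDerivAt D (a * Y t + γ * (1 - α) * D t - α * β * D t - δ * D t) t)
    (hV : ∀ t, HasDerivAt V (α * β * D t - c * V t) t)
    (hX0 : 0 < X 0) (hY0 : 0 ≤ Y 0) (hD0 : 0 ≤ D 0) (hV0 : 0 ≤ V 0) :
    Tendsto (fun t => (X t, Y t, D t, V t)) atTop
      (nhds (lam / μ, 0, 0, 0)) := by
  obtain ⟨hα0, hα1⟩ := hα
  set p := α * β with hp
  have hppos : 0 < p := mul_pos hα0 hβ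
  have hD' : ∀ t, HasDerivAt D (a * Y t - Rs * D t) t := fun t =>
    (hD t).congr_deriv (by rw [hRs]; ring)
  have cX : Continuous X := continuous_iff_continuousAt.2 fun t => (hX t).continuousAt
  have cV : Continuous V := continuous_iff_continuousAt.2 fun t => (hV t).continuousAt
  have Xpos := aux_pos lam μ k hlam X V cV hX hX0
  have nn := aux_nonneg δ a Rs p c hδ ha hRspos hppos hc (fun t => k * X t) Y D V (by fun_prop)
    (fun t ht => (mul_pos hk (Xpos t ht)).le)
    (fun t => (hY t).congr_deriv (by ring)) hD' hV hY0 hD0 hV0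
  set x := lam / μ with hx
  have hxpos : 0 < x := div_pos hlam hμ
  have hlx : lam = μ * x := by rw [hx]; field_simp
  set κ := δ * Rs / (a * p) * c - k * x with hκ
  have hκ0 : 0 ≤ κ := by
    rw [hR0, div_le_one (by positivity)] at hR0le
    have : k * x ≤ δ * Rs / (a * p) * c := by
      rw [hx, mul_div_assoc', div_mul_eq_mul_div, div_le_div_iff₀ hμ (by positivity), hp]
      linarith
    linarith
  -- Lyapunov function
  let L : ℝ → ℝ := fun t => (X t - x - x * Real.log (X t / x)) + Y t + δ / a * D t
    + δ * Rs / (a * p) * V t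
  let G : ℝ → ℝ := fun t => -(μ * ((X t - x) ^ 2 * (X t)⁻¹)) - κ * V t
  have hL : ∀ t, 0 ≤ t → HasDerivAt L (G t) t := by
    intro t ht
    have X0 := (Xpos t ht).ne'
    have hlog := ((hX t).div_const x).log (div_ne_zero X0 hxpos.ne')
    refine (((((hX t).sub_const x).sub (hlog.const_mul x)).add (hY t)).add
      ((hD' t).const_mul (δ / a))).add ((hV t).const_mul (δ * Rs / (a * p))) |>.congr_deriv ?_
    simp only [G, hκ]
    rw [hlx]
    field_simp
    ring
  have G0 : ∀ t, 0 ≤ t → G t ≤ 0 := by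
    intro t ht
    have h1 : 0 ≤ μ * ((X t - x) ^ 2 * (X t)⁻¹) := by
      have := Xpos t ht
      positivity
    have h2 : 0 ≤ κ * V t := mul_nonneg hκ0 (nn t ht).2.2
    simp only [G]; linarith
  have anti : AntitoneOn L (Set.Ici 0) := by
    refine antitoneOn_of_deriv_nonpos (convex_Ici 0)
      (fun t ht => (hL t ht).continuousAt.continuousWithinAt)
      (fun t ht => (hL t (interior_subset ht)).differentiableAt.differentiableWithinAt) ?_
    intro t ht
    rw [(hL t (interior_subset ht)).deriv]
    exact G0 t (interior_subset ht)
  have hXpart : ∀ t, 0 ≤ t → 0 ≤ X t - x - x * Real.log (X t / x) := by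
    intro t ht
    have h := mul_le_mul_of_nonneg_left
      (Real.log_le_sub_one_of_pos (div_pos (Xpos t ht) hxpos)) hxpos.le
    have e : x * (X t / x - 1) = X t - x := by field_simp
    linarith
  have c1 : 0 < δ / a := by positivity
  have c2 : 0 < δ * Rs / (a * p) := by positivity
  have hb : ∀ t, 0 ≤ t → X t - x - x * Real.log (X t / x) ≤ L 0 ∧ Y t ≤ L 0 ∧
      δ / a * D t ≤ L 0 ∧ δ * Rs / (a * p) * V t ≤ L 0 ∧ 0 ≤ L t := by
    intro t ht
    obtain ⟨y0, d0, v0⟩ := nn t ht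
    have h := anti (Set.mem_Ici.2 le_rfl) (Set.mem_Ici.2 ht) ht
    have h1 := hXpart t ht
    have h2 := mul_nonneg c1.le d0
    have h3 := mul_nonneg c2.le v0
    have e : L t = (X t - x - x * Real.log (X t / x)) + Y t + δ / a * D t
      + δ * Rs / (a * p) * V t := rfl
    refine ⟨?_, ?_, ?_, ?_, ?_⟩ <;> linarith
  have bY : AuxBdd Y := ⟨L 0, fun t ht => by
    rw [abs_of_nonneg (nn t ht).1]; exact (hb t ht).2.1⟩
  have bD : AuxBdd D := ⟨L 0 / (δ / a), fun t ht => by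
    rw [abs_of_nonneg (nn t ht).2.1, le_div_iff₀ c1, mul_comm]; exact (hb t ht).2.2.1⟩
  have bV : AuxBdd V := ⟨L 0 / (δ * Rs / (a * p)), fun t ht => by
    rw [abs_of_nonneg (nn t ht).2.2, le_div_iff₀ c2, mul_comm]; exact (hb t ht).2.2.2.1⟩
  have Xup : ∀ t, 0 ≤ t → X t ≤ 2 * (L 0 + x) := by
    intro t ht
    have hu : 0 < X t / x := div_pos (Xpos t ht) hxpos
    have h1 := Real.log_le_sub_one_of_pos (half_pos hu)
    rw [Real.log_div hu.ne' two_ne_zero] at h1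
    have h2 := Real.log_le_sub_one_of_pos (show (0 : ℝ) < 2 by norm_num)
    have h3 : Real.log (X t / x) ≤ X t / x / 2 := by linarith
    have h4 := mul_le_mul_of_nonneg_left h3 hxpos.le
    have e : x * (X t / x / 2) = X t / 2 := by field_simp
    linarith [(hb t ht).1]
  have bX : AuxBdd X := ⟨2 * (L 0 + x), fun t ht => by
    rw [abs_of_pos (Xpos t ht)]; exact Xup t ht⟩
  have bXi : AuxBdd fun t => (X t)⁻¹ := by
    refine ⟨(x * Real.exp (-(1 + L 0 / x)))⁻¹, fun t ht => ?_⟩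
    have hu : 0 < X t / x := div_pos (Xpos t ht) hxpos
    rw [abs_of_pos (inv_pos.2 (Xpos t ht))]
    refine inv_anti₀ (by positivity) ?_
    have h1 : -(1 + L 0 / x) ≤ Real.log (X t / x) := by
      have e : x * (1 + L 0 / x) = x + L 0 := by field_simp
      have h := (hb t ht).1
      have h' := Xpos t ht
      by_contra hcon
      push Not at hcon
      have := mul_lt_mul_of_pos_left hcon hxpos
      linarith
    have h2 := (Real.le_log_iff_exp_le hu).1 h1
    rw [le_div_iff₀ hxpos] at h2
    linarith
  have K := AuxBdd.const
  have bX' : AuxBdd fun t => lam - μ * X t - k * V t * X t :=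
    ((K lam).sub ((K μ).mul bX)).sub (((K k).mul bV).mul bX)
  have bY' : AuxBdd fun t => k * V t * X t - δ * Y t :=
    (((K k).mul bV).mul bX).sub ((K δ).mul bY)
  have bD' : AuxBdd fun t => a * Y t - Rs * D t := ((K a).mul bY).sub ((K Rs).mul bD)
  have bV' : AuxBdd fun t => p * D t - c * V t := ((K p).mul bD).sub ((K c).mul bV)
  -- the Lyapunov function converges
  obtain ⟨l, hl⟩ : ∃ l, Tendsto L atTop (nhds l) := by
    have h1 : Antitone fun t => L (max t 0) := fun s t hst =>
      anti (Set.mem_Ici.2 (le_max_right _ _)) (Set.mem_Ici.2 (le_max_right _ _))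
        (max_le_max_right 0 hst)
    have h2 : BddBelow (Set.range fun t => L (max t 0)) := by
      refine ⟨0, ?_⟩
      rintro _ ⟨t, rfl⟩
      exact (hb _ (le_max_right _ _)).2.2.2.2
    refine ⟨_, (tendsto_atTop_ciInf h1 h2).congr' ?_⟩
    filter_upwards [eventually_ge_atTop 0] with t ht
    rw [max_eq_left ht]
  have hGlim : Tendsto G atTop (nhds 0) := by
    have bXx : AuxBdd fun t => X t - x := bX.sub (K x)
    refine AuxBdd.barbalat (f := L) (l := l) (h := fun t =>
      (-1) * (μ * (2 * (X t - x) * (lam - μ * X t - k * V t * X t) * (X t)⁻¹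
        + (X t - x) * (X t - x) * ((-1) * (lam - μ * X t - k * V t * X t)
          * ((X t)⁻¹ * (X t)⁻¹)))) - κ * (p * D t - c * V t)) ?_ hL ?_ hl
    · exact ((K (-1)).mul ((K μ).mul (((((K 2).mul bXx).mul bX').mul bXi).add
        ((bXx.mul bXx).mul (((K (-1)).mul bX').mul (bXi.mul bXi)))))).sub ((K κ).mul bV')
    · intro t ht
      have X0 := (Xpos t ht).ne'
      refine (((((hX t).sub_const x).pow 2).mul ((hX t).inv X0)).const_mul μ).neg.sub
        ((hV t).const_mul κ) |>.congr_deriv ?_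
      simp only [Pi.pow_apply, Pi.inv_apply]
      field_simp
      ring
  have hXlim : Tendsto X atTop (nhds x) := by
    have hS : 0 < 2 * (L 0 + x) := (Xpos 0 le_rfl).trans_le (Xup 0 le_rfl)
    have h1 : Tendsto (fun t => 2 * (L 0 + x) / μ * (-G t)) atTop (nhds 0) := by
      simpa using hGlim.neg.const_mul (2 * (L 0 + x) / μ)
    have h2 : Tendsto (fun t => (X t - x) ^ 2) atTop (nhds 0) := by
      refine tendsto_of_tendsto_of_tendsto_of_le_of_le' tendsto_const_nhds h1
        (Eventually.of_forall fun t => sq_nonneg _) ?_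
      filter_upwards [eventually_ge_atTop 0] with t ht
      have hv := mul_nonneg hκ0 (nn t ht).2.2
      have hX1 := Xpos t ht
      have h3 : μ * ((X t - x) ^ 2 * (X t)⁻¹) ≤ -G t := by simp only [G]; linarith
      calc (X t - x) ^ 2 = X t / μ * (μ * ((X t - x) ^ 2 * (X t)⁻¹)) := by field_simp
        _ ≤ 2 * (L 0 + x) / μ * (μ * ((X t - x) ^ 2 * (X t)⁻¹)) :=
          mul_le_mul_of_nonneg_right (div_le_div_of_nonneg_right (Xup t ht) hμ.le) (by positivity)
        _ ≤ _ := mul_le_mul_of_nonneg_left h3 (by positivity)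
    have h3 := (Real.continuous_sqrt.tendsto 0).comp h2
    simp only [Function.comp_def, Real.sqrt_sq_eq_abs, Real.sqrt_zero] at h3
    have h4 := (tendsto_zero_iff_abs_tendsto_zero _).2 h3
    simpa using h4.add_const x
  have hX'lim : Tendsto (fun t => lam - μ * X t - k * V t * X t) atTop (nhds 0) := by
    refine AuxBdd.barbalat (f := X) (l := x) (h := fun t =>
      0 - μ * (lam - μ * X t - k * V t * X t) - (k * (p * D t - c * V t) * X t
        + k * V t * (lam - μ * X t - k * V t * X t))) ?_ (fun t _ => hX t) ?_ hXlim
    · exact ((K 0).sub ((K μ).mul bX')).sub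
        ((((K k).mul bV').mul bX).add (((K k).mul bV).mul bX'))
    · intro t _
      exact ((hasDerivAt_const t lam).sub ((hX t).const_mul μ)).sub
        (((hV t).const_mul k).mul (hX t))
  have hVlim : Tendsto V atTop (nhds 0) := by
    have h1 : Tendsto (fun t => (lam - μ * X t - (lam - μ * X t - k * V t * X t)) / (k * X t))
        atTop (nhds ((lam - μ * x - 0) / (k * x))) :=
      ((tendsto_const_nhds.sub (hXlim.const_mul μ)).sub hX'lim).div (hXlim.const_mul k)
        (by positivity)
    rw [← hlx, sub_self, sub_zero, zero_div] at h1
    refine h1.congr' ?_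
    filter_upwards [eventually_ge_atTop 0] with t ht
    have := Xpos t ht
    field_simp
    ring
  have hV'lim : Tendsto (fun t => p * D t - c * V t) atTop (nhds 0) :=
    AuxBdd.barbalat (((K p).mul bD').sub ((K c).mul bV')) (fun t _ => hV t)
      (fun t _ => ((hD' t).const_mul p).sub ((hV t).const_mul c)) hVlim
  have hDlim : Tendsto D atTop (nhds 0) := by
    have h1 := (hV'lim.add (hVlim.const_mul c)).div_const p
    simp only [mul_zero, add_zero, zero_div] at h1
    refine h1.congr fun t => ?_
    field_simp
    ring
  have hD'lim : Tendsto (fun t => a * Y t - Rs * D t) atTop (nhds 0) :=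
    AuxBdd.barbalat (((K a).mul bY').sub ((K Rs).mul bD')) (fun t _ => hD' t)
      (fun t _ => ((hY t).const_mul a).sub ((hD' t).const_mul Rs)) hDlim
  have hYlim : Tendsto Y atTop (nhds 0) := by
    have h1 := (hD'lim.add (hDlim.const_mul Rs)).div_const a
    simp only [mul_zero, add_zero, zero_div] at h1
    refine h1.congr fun t => ?_
    field_simp
    ring
  exact hXlim.prodMk_nhds (hYlim.prodMk_nhds (hDlim.prodMk_nhds hVlim))
end

section
/- Regard the basic reproduction number R_0(γ) = akλαβ/((cαβδ − cγδ + cαγδ + cδ²)μ) as a function of the recycling rate γ on the interval where α(β+γ) − γ + δ > 0 and γ > 0. Then its elasticity with respect to γ satisfies (γ/R_0)·dR_0/dγ = ((1−α)γ)/(α(β+γ) − γ + δ). -/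
/-- Elasticity of the basic reproduction number with respect to the recycling
rate γ: for R₀(γ) = akλαβ/((cαβδ − cγδ + cαγδ + cδ²)μ), on the region where
γ > 0 and α(β+γ) − γ + δ > 0,
(γ/R₀)·dR₀/dγ = (1−α)γ/(α(β+γ) − γ + δ). -/
theorem hbv_elasticity_R0_gamma
    (lam μ k δ a β c α : ℝ)
    (hlam : 0 < lam) (hμ : 0 < μ) (hk : 0 < k) (hδ : 0 < δ)
    (ha : 0 < a) (hβ : 0 < β) (hc : 0 < c)
    (hα : α ∈ Set.Ioo (0 : ℝ) 1)
    (R₀ : ℝ → ℝ)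
    (hR0 : R₀ = fun γ => a * k * lam * α * β /
      ((c * α * β * δ - c * γ * δ + c * α * γ * δ + c * δ ^ 2) * μ)) :
    ∀ γ : ℝ, 0 < γ → 0 < α * (β + γ) - γ + δ →
      (γ / R₀ γ) * deriv R₀ γ = (1 - α) * γ / (α * (β + γ) - γ + δ) := by
  intro γ hγ hS
  obtain ⟨hα0, hα1⟩ := hα
  have hfun : R₀ = fun x => a * k * lam * α * β /
      (c * δ * μ * (α * (β + x) - x + δ)) := by
    rw [hR0]
    funext x
    congr 1
    ring
  have hSne : α * (β + γ) - γ + δ ≠ 0 := hS.ne'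
  have hden : HasDerivAt (fun x : ℝ => c * δ * μ * (α * (β + x) - x + δ))
      (c * δ * μ * (α * 1 - 1)) γ :=
    (((((hasDerivAt_id γ).const_add β).const_mul α).sub
      (hasDerivAt_id γ)).add_const δ).const_mul (c * δ * μ)
  have hne : c * δ * μ * (α * (β + γ) - γ + δ) ≠ 0 := by positivity
  have hd := (hasDerivAt_const γ (a * k * lam * α * β)).fun_div hden hne
  rw [hfun, hd.deriv]
  beta_reduce
  generalize α * (β + γ) - γ + δ = S at *
  field_simp
  ring
end
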